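/- Refinement with positive strictly decreasing test functions: under the hypotheses of the lower bounds for approximation by logarithmic-derivative families (both the second-order family (1/b_{M,N})(k + ∂_x((∂_xψ)/ψ)) on Ω_{N,M} and the first-order antiderivative family (1/b_N)((∂_xψ)/ψ)), with l = m + α, m ≥ 1 integer, 0 < α ≤ 1, the extremal function h ∈ Λ_l([0,1]) ∩ C^m([0,1]) realizing the lower bound C̃/((N+M)^l (ln(N+M))^l) (respectively C̃/(N^{l+1}(ln N)^{l+1}) for the antiderivative family) can in addition be chosen so that h > 0 on [0,1], h is strictly decreasing on [0,1], and h^{(j)}(0) = 0 for all j = 1, …, m. -/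

import Mathlib

open Set

noncomputable section

/-- The interval `I = [0,1]`. -/
def I01 : Set ℝ := Icc 0 1

/-- The one-dimensional Hölder class `Λ_l([0,1])`, `l = m + α`, `0 < α ≤ 1`. -/
def HolderClass1 (m : ℕ) (α : ℝ) (f : ℝ → ℝ) : Prop :=
  ContDiffOn ℝ m f I01 ∧
  (∀ j ≤ m, ∀ x ∈ I01, |iteratedDerivWithin j f I01 x| ≤ 1) ∧
  ∀ x ∈ I01, ∀ y ∈ I01,
    |iteratedDerivWithin m f I01 x - iteratedDerivWithin m f I01 y| ≤ |x - y| ^ α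

/-- The product `W^M` of half-planes `W = {Re z > 0}`. -/
def Wset (M : ℕ) : Set (Fin M → ℂ) := {w | ∀ i, 0 < (w i).re}

/-- A function `g(x,ζ,w)` on `[0,1] × ℂ^N × W^M`, continuous in `x`, entire in `ζ`,
holomorphic in `w`, with exponential growth bound. -/
def GoodFamily (N M : ℕ) (A u v b t d : ℝ)
    (g : ℝ → (Fin N → ℂ) → (Fin M → ℂ) → ℂ) : Prop :=
  (∀ ζ : Fin N → ℂ, ∀ w ∈ Wset M, ContinuousOn (fun x => g x ζ w) I01) ∧
  (∀ x ∈ I01, ∀ w ∈ Wset M, AnalyticOnNhd ℂ (fun ζ => g x ζ w) univ) ∧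
  (∀ x ∈ I01, ∀ ζ : Fin N → ℂ, AnalyticOnNhd ℂ (fun w => g x ζ w) (Wset M)) ∧
  ∀ ζ : Fin N → ℂ, ∀ w ∈ Wset M, ∀ x ∈ I01,
    ‖g x ζ w‖ ≤ A * Real.exp (u * ((N:ℝ) + M) ^ v) *
      Real.exp (b * ((N:ℝ) + M) ^ t * ((∑ j, ‖ζ j‖) ^ d + (∑ i, ‖w i‖) ^ d))

/-- Membership in `Ω_{N,M}` (real parameters). -/
def InOmega (N M : ℕ) (B₁ r₁ ε : ℝ) (a : Fin M → ℝ)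
    (ζ : Fin N → ℝ) (w : Fin M → ℝ) : Prop :=
  (∀ j, |ζ j| ≤ B₁ * ((M:ℝ) + N) ^ r₁) ∧
  ∀ i, 0 < w i ∧ |w i - a i| ≤ (1 - ε) * a i

/-- Discrete orthogonality for roots of unity. -/
lemma rootSum {T : ℕ} (hT : 0 < T) {ω : ℂ} (hω : IsPrimitiveRoot ω T) (n j : ℕ) (hn : n < T)
    (hj : j < T) :
    ∑ k : Fin T, (ω ^ (k:ℕ)) ^ n * ((ω ^ (k:ℕ))⁻¹) ^ j = if n = j then (T:ℂ) else 0 := by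
  have hω0 : ω ≠ 0 := hω.ne_zero hT.ne'
  split_ifs with h
  · subst h
    have : ∀ k : Fin T, (ω ^ (k:ℕ)) ^ n * ((ω ^ (k:ℕ))⁻¹) ^ n = 1 := by
      intro k
      rw [← mul_pow, mul_inv_cancel₀ (pow_ne_zero _ hω0), one_pow]
    rw [Finset.sum_congr rfl (fun k _ => this k)]
    simp
  · set x : ℂ := ω ^ n * (ω⁻¹) ^ j with hx
    have hx1 : x ≠ 1 := by
      intro h1
      apply h
      have : ω ^ n = ω ^ j := by
        have h2 : x * ω ^ j = ω ^ n := by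
          rw [hx, mul_assoc, ← mul_pow, inv_mul_cancel₀ hω0, one_pow, mul_one]
        rw [← h2, h1, one_mul]
      exact hω.pow_inj hn hj this
    have hxT : x ^ T = 1 := by
      rw [hx, mul_pow, ← pow_mul, ← pow_mul, mul_comm n, mul_comm j, pow_mul, pow_mul, inv_pow,
        hω.pow_eq_one]
      simp
    have h3 : ∀ k : Fin T, (ω ^ (k:ℕ)) ^ n * ((ω ^ (k:ℕ))⁻¹) ^ j = x ^ (k:ℕ) := by
      intro k
      rw [hx, mul_pow, ← inv_pow, ← pow_mul, ← pow_mul, ← pow_mul, ← pow_mul, mul_comm n,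
        mul_comm j]
    simp_rw [h3]
    rw [Fin.sum_univ_eq_sum_range (fun k => x ^ k) T, geom_sum_eq hx1, hxT]
    simp

/-- One-variable interpolation at roots of unity, with geometric error. -/
lemma interp (c : ℂ) (ρ q : ℝ) (hρ : 0 < ρ) (hq0 : 0 < q) (hq1 : q < 1) (T : ℕ) (hT : 0 < T) :
    ∃ (nodes : Fin T → ℂ) (l : Fin T → ℂ → ℂ),
      (∀ k, nodes k ∈ Metric.closedBall c ρ) ∧
      (∀ k, ∀ z ∈ Metric.closedBall c ρ, ‖l k z‖ ≤ 1) ∧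
      ∀ (f : ℂ → ℂ) (E : ℝ), DifferentiableOn ℂ f (Metric.closedBall c (ρ / q)) →
        (∀ z ∈ Metric.closedBall c (ρ / q), ‖f z‖ ≤ E) →
        ∀ z ∈ Metric.closedBall c ρ,
          ‖f z - ∑ k, f (nodes k) * l k z‖ ≤ E * (2 * q ^ T / (1 - q)) := by
  obtain ⟨ω, hω⟩ : ∃ ω : ℂ, IsPrimitiveRoot ω T := ⟨_, Complex.isPrimitiveRoot_exp T hT.ne'⟩
  have hωn : ‖ω‖ = 1 := hω.norm'_eq_one hT.ne'
  have hω0 : ω ≠ 0 := hω.ne_zero hT.ne'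
  have hρC : (ρ:ℂ) ≠ 0 := by exact_mod_cast hρ.ne'
  have hTC : (T:ℂ) ≠ 0 := by exact_mod_cast hT.ne'
  refine ⟨fun k => c + ρ * ω ^ (k:ℕ), fun k z =>
    (T:ℂ)⁻¹ * ∑ j ∈ Finset.range T, ((z - c) / ρ * (ω ^ (k:ℕ))⁻¹) ^ j, ?_, ?_, ?_⟩
  · intro k
    simp [hωn, abs_of_pos hρ]
  · intro k z hz
    have hu : ‖(z - c) / ρ‖ ≤ 1 := by
      rw [mem_closedBall_iff_norm] at hz
      rw [norm_div, Complex.norm_real, Real.norm_eq_abs, abs_of_pos hρ]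
      exact div_le_one_of_le₀ hz hρ.le
    rw [norm_mul, norm_inv, Complex.norm_natCast]
    have : ‖∑ j ∈ Finset.range T, ((z - c) / ρ * (ω ^ (k:ℕ))⁻¹) ^ j‖ ≤ T := by
      refine (norm_sum_le _ _).trans ?_
      calc _ ≤ ∑ j ∈ Finset.range T, (1:ℝ) := by
            apply Finset.sum_le_sum
            intro j _
            rw [norm_pow, norm_mul, norm_inv, norm_pow, hωn]
            simp only [one_pow, inv_one, mul_one]
            exact pow_le_one₀ (norm_nonneg _) hu
        _ = T := by simp
    calc (T:ℝ)⁻¹ * _ ≤ (T:ℝ)⁻¹ * T := by gcongr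
      _ = 1 := by field_simp
  · intro f E hf hE z hz
    set R := ρ / q with hR
    have hRpos : 0 < R := by positivity
    have hρR : ρ < R := by rw [hR, lt_div_iff₀ hq0]; nlinarith
    have hE0 : 0 ≤ E := (norm_nonneg _).trans (hE c (by simp [hRpos.le]))
    set u : ℂ := (z - c) / ρ with hu
    have hu1 : ‖u‖ ≤ 1 := by
      rw [mem_closedBall_iff_norm] at hz
      rw [hu, norm_div, Complex.norm_real, Real.norm_eq_abs, abs_of_pos hρ]
      exact div_le_one_of_le₀ hz hρ.le
    set e : ℕ → ℂ := fun n => ((n.factorial : ℂ))⁻¹ * (ρ:ℂ) ^ n * iteratedDeriv n f c with he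
    have hser : ∀ v : ℂ, ‖v‖ ≤ 1 → HasSum (fun n => e n * v ^ n) (f (c + ρ * v)) := by
      intro v hv
      have hmem : c + ρ * v ∈ Metric.ball c R := by
        rw [mem_ball_iff_norm]
        simp only [add_sub_cancel_left, norm_mul, Complex.norm_real, Real.norm_eq_abs,
          abs_of_pos hρ]
        nlinarith
      have := Complex.hasSum_taylorSeries_on_ball
        (hf.mono Metric.ball_subset_closedBall) hmem
      have h2 : (fun n => e n * v ^ n) = fun n : ℕ => ((n.factorial : ℂ))⁻¹ •
          (c + ρ * v - c) ^ n • iteratedDeriv n f c := by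
        funext n
        simp only [he, add_sub_cancel_left, smul_eq_mul, mul_pow]
        ring
      rw [h2]
      exact this
    have hen : ∀ n, ‖e n‖ ≤ E * q ^ n := by
      intro n
      have h1 := Complex.norm_iteratedDeriv_le_of_forall_mem_sphere_norm_le (c := c) (R := R)
        (C := E) (f := f) n hRpos
        ((hf.mono (by rw [closure_ball _ hRpos.ne'])).diffContOnCl)
        (fun z hz => hE z (Metric.sphere_subset_closedBall hz))
      have hq : q = ρ / R := by rw [hR]; field_simp
      simp only [he, norm_mul, norm_inv, Complex.norm_natCast, norm_pow, Complex.norm_real,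
        Real.norm_eq_abs, abs_of_pos hρ]
      have hfac : (0:ℝ) < n.factorial := by exact_mod_cast n.factorial_pos
      calc (n.factorial:ℝ)⁻¹ * ρ ^ n * ‖iteratedDeriv n f c‖
          ≤ (n.factorial:ℝ)⁻¹ * ρ ^ n * (n.factorial * E / R ^ n) := by gcongr
        _ = E * q ^ n := by 
            have h7 : q ^ n = ρ ^ n / R ^ n := by rw [← div_pow, ← hq]
            rw [h7]; field_simp
    -- values of the interpolant on monomials
    have hmon : ∀ n : ℕ, ∑ k : Fin T, (ω ^ (k:ℕ)) ^ n *
        ((T:ℂ)⁻¹ * ∑ j ∈ Finset.range T, (u * (ω ^ (k:ℕ))⁻¹) ^ j) = u ^ (n % T) := by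
      intro n
      have h0 : ∀ k : Fin T, (ω ^ (k:ℕ)) ^ n = (ω ^ (k:ℕ)) ^ (n % T) := by
        intro k
        conv_lhs => rw [← Nat.div_add_mod n T]
        rw [pow_add, pow_mul, ← pow_mul ω, mul_comm (k:ℕ) T, pow_mul ω, hω.pow_eq_one]
        simp
      simp_rw [h0, mul_pow, Finset.mul_sum]
      rw [Finset.sum_comm]
      have h1 : ∀ j ∈ Finset.range T, ∑ k : Fin T, (ω ^ (k:ℕ)) ^ (n % T) *
          ((T:ℂ)⁻¹ * (u ^ j * ((ω ^ (k:ℕ))⁻¹) ^ j)) = if n % T = j then u ^ j else 0 := by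
        intro j hj
        have h2 : ∀ k : Fin T, (ω ^ (k:ℕ)) ^ (n % T) *
          ((T:ℂ)⁻¹ * (u ^ j * ((ω ^ (k:ℕ))⁻¹) ^ j)) = ((T:ℂ)⁻¹ * u ^ j) *
            ((ω ^ (k:ℕ)) ^ (n % T) * ((ω ^ (k:ℕ))⁻¹) ^ j) := by intro k; ring
        simp_rw [h2]
        rw [← Finset.mul_sum, rootSum hT hω _ _ (Nat.mod_lt _ hT) (Finset.mem_range.1 hj)]
        split_ifs
        · field_simp
        · simp
      rw [Finset.sum_congr rfl h1, Finset.sum_ite_eq]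
      simp [Nat.mod_lt _ hT]
    have hz' : z = c + ρ * u := by rw [hu]; field_simp; ring
    have hs1 : HasSum (fun n => e n * u ^ n) (f z) := by
      have := hser u hu1
      rwa [← hz'] at this
    have hs2 : HasSum (fun n => ∑ k : Fin T, (e n * (ω ^ (k:ℕ)) ^ n) *
        ((T:ℂ)⁻¹ * ∑ j ∈ Finset.range T, (u * (ω ^ (k:ℕ))⁻¹) ^ j))
        (∑ k : Fin T, f (c + ρ * ω ^ (k:ℕ)) *
          ((T:ℂ)⁻¹ * ∑ j ∈ Finset.range T, (u * (ω ^ (k:ℕ))⁻¹) ^ j)) := by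
      apply hasSum_sum
      intro k _
      apply HasSum.mul_right
      apply hser
      rw [norm_pow, hωn, one_pow]
    have hs3 := hs1.sub hs2
    have hs4 : HasSum (fun n => E * (2 * q ^ T) * q ^ n) (E * (2 * q ^ T) * (1 - q)⁻¹) :=
      (hasSum_geometric_of_lt_one hq0.le hq1).mul_left _
    have hterm : ∀ n, e n * u ^ n - ∑ k : Fin T, (e n * (ω ^ (k:ℕ)) ^ n) *
        ((T:ℂ)⁻¹ * ∑ j ∈ Finset.range T, (u * (ω ^ (k:ℕ))⁻¹) ^ j)
        = e n * (u ^ n - u ^ (n % T)) := by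
      intro n
      simp_rw [mul_assoc (e n)]
      rw [← Finset.mul_sum, hmon n]
      ring
    simp_rw [hterm] at hs3
    rw [← hasSum_nat_add_iff' T] at hs3
    have hzero : ∑ i ∈ Finset.range T, e i * (u ^ i - u ^ (i % T)) = 0 := by
      apply Finset.sum_eq_zero
      intro i hi
      rw [Nat.mod_eq_of_lt (Finset.mem_range.1 hi)]
      ring
    rw [hzero, sub_zero] at hs3
    have hb : ∀ n, ‖e (n + T) * (u ^ (n + T) - u ^ ((n + T) % T))‖ ≤ E * (2 * q ^ T) * q ^ n := by
      intro n
      rw [norm_mul]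
      have h5 : ‖u ^ (n + T) - u ^ ((n + T) % T)‖ ≤ 2 := by
        refine (norm_sub_le _ _).trans ?_
        rw [norm_pow, norm_pow]
        have := pow_le_one₀ (n := n + T) (norm_nonneg u) hu1
        have := pow_le_one₀ (n := (n + T) % T) (norm_nonneg u) hu1
        linarith
      calc _ ≤ (E * q ^ (n + T)) * 2 := by
            gcongr
            exact hen _
        _ = _ := by rw [pow_add]; ring
    have := tsum_of_norm_bounded hs4 hb
    rw [hs3.tsum_eq] at this
    calc _ ≤ _ := this
      _ = _ := by rw [div_eq_mul_inv]; ring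

/-- A function of several variables, separately holomorphic on a polydisc and vanishing on a
tensor grid, is small. -/
lemma grid_small {ι : Type*} [Fintype ι] [DecidableEq ι] (c : ι → ℂ) (ρ : ι → ℝ) (q : ℝ)
    (hq0 : 0 < q) (hq1 : q < 1) (hρ : ∀ j, 0 < ρ j) (T : ℕ) (hT : 0 < T) :
    ∃ (nodes : ι → Fin T → ℂ),
      (∀ j k, nodes j k ∈ Metric.closedBall (c j) (ρ j)) ∧
      ∀ (f : (ι → ℂ) → ℂ) (E : ℝ),
        (∀ z : ι → ℂ, (∀ j, z j ∈ Metric.closedBall (c j) (ρ j / q)) → ∀ j,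
          DifferentiableOn ℂ (fun t => f (Function.update z j t))
            (Metric.closedBall (c j) (ρ j / q))) →
        (∀ z : ι → ℂ, (∀ j, z j ∈ Metric.closedBall (c j) (ρ j / q)) → ‖f z‖ ≤ E) →
        (∀ κ : ι → Fin T, f (fun j => nodes j (κ j)) = 0) →
        ∀ z : ι → ℂ, (∀ j, z j ∈ Metric.closedBall (c j) (ρ j)) →
          ‖f z‖ ≤ E * (2 * q ^ T / (1 - q)) * ((T:ℝ) + 1) ^ (Fintype.card ι) := by
  choose nodes l hn hl hf using fun j => interp (c j) (ρ j) q (hρ j) hq0 hq1 T hT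
  refine ⟨nodes, hn, ?_⟩
  intro f E hdiff hE hzero
  have hsub : ∀ j, Metric.closedBall (c j) (ρ j) ⊆ Metric.closedBall (c j) (ρ j / q) := by
    intro j
    apply Metric.closedBall_subset_closedBall
    rw [le_div_iff₀ hq0]
    nlinarith [hρ j]
  have hE0 : 0 ≤ E := (norm_nonneg _).trans (hE c (fun j => hsub j (by simp [(hρ j).le])))
  have hη0 : 0 ≤ E * (2 * q ^ T / (1 - q)) := by
    have : 0 < 1 - q := by linarith
    positivity
  have key : ∀ S : Finset ι, ∀ z : ι → ℂ, (∀ j, z j ∈ Metric.closedBall (c j) (ρ j)) →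
      (∀ j, j ∉ S → ∃ k, z j = nodes j k) →
      ‖f z‖ ≤ E * (2 * q ^ T / (1 - q)) * ((T:ℝ) + 1) ^ S.card := by
    intro S
    induction S using Finset.induction_on with
    | empty =>
      intro z _ h
      choose κ hκ using fun j => h j (by simp)
      have : z = fun j => nodes j (κ j) := funext hκ
      rw [this, hzero]
      simpa using hη0
    | insert j S hj ih =>
      intro z hz h
      have h1 := hf j (fun t => f (Function.update z j t)) E
        (hdiff z (fun i => hsub i (hz i)) j) (by
          intro t ht
          apply hE
          intro i
          by_cases hij : i = j
          · subst hij; simpa using ht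
          · simpa [hij] using hsub i (hz i)) (z j) (hz j)
      rw [Function.update_eq_self] at h1
      have h2 : ∀ k, ‖f (Function.update z j (nodes j k))‖ ≤
          E * (2 * q ^ T / (1 - q)) * ((T:ℝ) + 1) ^ S.card := by
        intro k
        apply ih
        · intro i
          by_cases hij : i = j
          · subst hij; simpa using hn _ k
          · simpa [hij] using hz i
        · intro i hi
          by_cases hij : i = j
          · subst hij; exact ⟨k, by simp⟩
          · simpa [hij] using h i (by simp [hij, hi])
      have h3 : ‖∑ k, f (Function.update z j (nodes j k)) * l j k (z j)‖ ≤
          T * (E * (2 * q ^ T / (1 - q)) * ((T:ℝ) + 1) ^ S.card) := by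
        refine (norm_sum_le _ _).trans ?_
        calc _ ≤ ∑ k : Fin T, (E * (2 * q ^ T / (1 - q)) * ((T:ℝ) + 1) ^ S.card) := by
              apply Finset.sum_le_sum
              intro k _
              rw [norm_mul]
              calc _ ≤ (E * (2 * q ^ T / (1 - q)) * ((T:ℝ) + 1) ^ S.card) * 1 := by
                    gcongr
                    · exact h2 k
                    · exact hl j k _ (hz j)
                _ = _ := mul_one _
          _ = _ := by simp
      have h4 : ‖f z‖ ≤ ‖f z - ∑ k, f (Function.update z j (nodes j k)) * l j k (z j)‖ +
          ‖∑ k, f (Function.update z j (nodes j k)) * l j k (z j)‖ := by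
        simpa using norm_add_le (f z - ∑ k, f (Function.update z j (nodes j k)) * l j k (z j))
          (∑ k, f (Function.update z j (nodes j k)) * l j k (z j))
      rw [Finset.card_insert_of_notMem hj, pow_succ]
      have h5 : (1:ℝ) ≤ ((T:ℝ) + 1) ^ S.card := one_le_pow₀ (by linarith [Nat.cast_nonneg (α := ℝ) T])
      nlinarith [mul_le_mul_of_nonneg_left h5 hη0]
  intro z hz
  exact key Finset.univ z hz (by simp)

/-- Signs. -/
def sgn (b : Bool) : ℝ := if b then 1 else -1

lemma sgn_mul_self (b : Bool) : sgn b * sgn b = 1 := by cases b <;> simp [sgn]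
lemma sgn_abs (b : Bool) : |sgn b| = 1 := by cases b <;> simp [sgn]
lemma sgn_not (b : Bool) : sgn (!b) = - sgn b := by cases b <;> simp [sgn]

/-- The domination estimate: if `z` realizes the sign pattern `s₀` robustly, then the product
attached to `s₀` dominates all others together. -/
lemma pattern_dom (P : ℕ) (hP : 0 < P) (H G : Fin P → ℂ) (s₀ : Fin P → Bool)
    (hG : ∀ i, ‖G i - (sgn (s₀ i) : ℂ) * H i‖ ≤ ‖H i‖ / 10) :
    (∏ i, ‖H i‖ ^ P ≤ ∏ i, ‖H i + (sgn (s₀ i) : ℂ) * G i‖ ^ P) ∧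
    ∑ s : Fin P → Bool, ∏ i, ‖H i + (sgn (s i) : ℂ) * G i‖ ^ P ≤
      4 / 3 * ∏ i, ‖H i + (sgn (s₀ i) : ℂ) * G i‖ ^ P := by
  have hsq : ∀ b, (sgn b : ℂ) * (sgn b : ℂ) = 1 := by
    intro b; exact_mod_cast sgn_mul_self b
  have hnorm : ∀ b, ‖(sgn b : ℂ)‖ = 1 := by
    intro b; rw [Complex.norm_real, Real.norm_eq_abs, sgn_abs]
  have hv : ∀ i, ‖H i + (sgn (!s₀ i) : ℂ) * G i‖ ≤ ‖H i‖ / 10 := by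
    intro i
    have : H i + (sgn (!s₀ i) : ℂ) * G i = -((sgn (s₀ i) : ℂ) * (G i - (sgn (s₀ i) : ℂ) * H i)) := by
      rw [sgn_not]
      push_cast
      linear_combination (-H i) * hsq (s₀ i)
    rw [this, norm_neg, norm_mul, hnorm, one_mul]
    exact hG i
  have hu : ∀ i, 19 / 10 * ‖H i‖ ≤ ‖H i + (sgn (s₀ i) : ℂ) * G i‖ := by
    intro i
    have h1 : (2:ℂ) * H i = (H i + (sgn (s₀ i) : ℂ) * G i) + (H i + (sgn (!s₀ i) : ℂ) * G i) := by
      rw [sgn_not]; push_cast; ring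
    have h2 : ‖(2:ℂ) * H i‖ = 2 * ‖H i‖ := by simp
    have h3 := norm_add_le (H i + (sgn (s₀ i) : ℂ) * G i) (H i + (sgn (!s₀ i) : ℂ) * G i)
    rw [← h1, h2] at h3
    linarith [hv i]
  constructor
  · apply Finset.prod_le_prod
    · intro i _; positivity
    · intro i _
      gcongr
      linarith [hu i, norm_nonneg (H i)]
  · have h1 : ∑ s : Fin P → Bool, ∏ i, ‖H i + (sgn (s i) : ℂ) * G i‖ ^ P =
        ∏ i, ∑ b : Bool, ‖H i + (sgn b : ℂ) * G i‖ ^ P := by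
      rw [Finset.prod_univ_sum, Fintype.piFinset_univ]
    have hP' : (0:ℝ) < P := by exact_mod_cast hP
    have h19 : 4 * (P:ℝ) ≤ 19 ^ P := by
      have := one_add_mul_le_pow (a := (18:ℝ)) (by norm_num) P
      norm_num at this
      linarith
    have h2 : ∀ i, ∑ b : Bool, ‖H i + (sgn b : ℂ) * G i‖ ^ P ≤
        (1 + 1 / (4 * P)) * ‖H i + (sgn (s₀ i) : ℂ) * G i‖ ^ P := by
      intro i
      have h3 : ∑ b : Bool, ‖H i + (sgn b : ℂ) * G i‖ ^ P =
          ‖H i + (sgn (s₀ i) : ℂ) * G i‖ ^ P + ‖H i + (sgn (!s₀ i) : ℂ) * G i‖ ^ P := by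
        rw [Fintype.sum_bool]
        cases s₀ i <;> simp [add_comm]
      rw [h3]
      have h4 : ‖H i + (sgn (!s₀ i) : ℂ) * G i‖ ^ P ≤
          (1 / 19 * ‖H i + (sgn (s₀ i) : ℂ) * G i‖) ^ P := by
        gcongr
        linarith [hu i, hv i]
      rw [mul_pow, one_div, inv_pow] at h4
      have h5 : ((19:ℝ) ^ P)⁻¹ ≤ 1 / (4 * P) := by
        rw [one_div]
        exact inv_anti₀ (by positivity) h19
      have h6 : ((19:ℝ) ^ P)⁻¹ * ‖H i + (sgn (s₀ i) : ℂ) * G i‖ ^ P ≤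
        1 / (4 * P) * ‖H i + (sgn (s₀ i) : ℂ) * G i‖ ^ P := by gcongr
      linarith
    rw [h1]
    calc _ ≤ ∏ i : Fin P, ((1 + 1 / (4 * (P:ℝ))) * ‖H i + (sgn (s₀ i) : ℂ) * G i‖ ^ P) := by
          apply Finset.prod_le_prod
          · intro i _; positivity
          · intro i _; exact h2 i
      _ = (1 + 1 / (4 * (P:ℝ))) ^ P * ∏ i : Fin P, ‖H i + (sgn (s₀ i) : ℂ) * G i‖ ^ P := by
          rw [Finset.prod_mul_distrib]; simp
      _ ≤ _ := by
          gcongr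
          have h7 : (1 + 1 / (4 * (P:ℝ))) ≤ Real.exp (1 / (4 * (P:ℝ))) := by
            linarith [Real.add_one_le_exp (1 / (4 * (P:ℝ)))]
          have h8 : (1 + 1 / (4 * (P:ℝ))) ^ P ≤ Real.exp (1/4) := by
            calc _ ≤ Real.exp (1 / (4 * (P:ℝ))) ^ P := by gcongr
              _ = Real.exp (1/4) := by
                rw [← Real.exp_nat_mul]; congr 1; field_simp
          have h9 : 3 / 4 ≤ Real.exp (-(1/4)) := by
            linarith [Real.add_one_le_exp (-(1/4:ℝ))]
          have h10 : Real.exp (1/4) * Real.exp (-(1/4)) = 1 := by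
            rw [← Real.exp_add]; simp
          nlinarith [Real.exp_pos (1/4)]

/-- The core counting argument: a sign pattern avoided by both families. -/
lemma core {ι : Type*} [Fintype ι] [DecidableEq ι] (c : ι → ℂ) (ρ : ι → ℝ) (q : ℝ)
    (hq0 : 0 < q) (hq1 : q < 1) (hρ : ∀ j, 0 < ρ j) (T P : ℕ) (hT : 0 < T) (hP : 0 < P)
    (hTP : 2 * T ^ Fintype.card ι < 2 ^ P) (X δ : ℝ) (hX : 0 < X) (hδ : 0 < δ)
    (hnum : 2 * 2 ^ P * X ^ (P * P) * (2 * q ^ T / (1 - q)) * ((T:ℝ) + 1) ^ Fintype.card ι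
      < δ ^ (P * P))
    (H G : Bool → Fin P → (ι → ℂ) → ℂ)
    (hHd : ∀ f i, ∀ z : ι → ℂ, (∀ j, z j ∈ Metric.closedBall (c j) (ρ j / q)) → ∀ j,
          DifferentiableOn ℂ (fun t => H f i (Function.update z j t))
            (Metric.closedBall (c j) (ρ j / q)))
    (hGd : ∀ f i, ∀ z : ι → ℂ, (∀ j, z j ∈ Metric.closedBall (c j) (ρ j / q)) → ∀ j,
          DifferentiableOn ℂ (fun t => G f i (Function.update z j t))
            (Metric.closedBall (c j) (ρ j / q)))
    (hb : ∀ f i, ∀ z : ι → ℂ, (∀ j, z j ∈ Metric.closedBall (c j) (ρ j / q)) →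
      ‖H f i z‖ + ‖G f i z‖ ≤ X) :
    ∃ s : Fin P → Bool, ∀ f, ∀ z : ι → ℂ, (∀ j, z j ∈ Metric.closedBall (c j) (ρ j)) →
      (∀ i, δ ≤ ‖H f i z‖) → ∃ i, ‖H f i z‖ / 10 < ‖G f i z - (sgn (s i) : ℂ) * H f i z‖ := by
  obtain ⟨nodes, hn, hsmall⟩ := grid_small c ρ q hq0 hq1 hρ T hT
  have hnorm : ∀ b, ‖(sgn b : ℂ)‖ = 1 := by
    intro b; rw [Complex.norm_real, Real.norm_eq_abs, sgn_abs]
  set Φ : Bool → (Fin P → Bool) → (ι → ℂ) → ℂ := fun f s z =>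
    ∏ i, (H f i z + (sgn (s i) : ℂ) * G f i z) ^ P with hΦ
  -- linear algebra
  obtain ⟨C, hC0, hC⟩ : ∃ C : (Fin P → Bool) → ℂ, C ≠ 0 ∧ ∀ f (κ : ι → Fin T),
      ∑ s, C s * Φ f s (fun j => nodes j (κ j)) = 0 := by
    let A : Matrix (Bool × (ι → Fin T)) (Fin P → Bool) ℂ :=
      Matrix.of fun p s => Φ p.1 s (fun j => nodes j (p.2 j))
    have hker := LinearMap.ker_ne_bot_of_finrank_lt (f := Matrix.mulVecLin A) (by
      simpa using hTP)
    obtain ⟨C, hC, hC0⟩ := (Submodule.ne_bot_iff _).1 hker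
    refine ⟨C, hC0, ?_⟩
    intro f κ
    have h1 : A.mulVec C = 0 := by simpa using hC
    have h2 := congrFun h1 (f, κ)
    simp only [Matrix.mulVec, dotProduct, A, Matrix.of_apply, Pi.zero_apply] at h2
    rw [← h2]
    exact Finset.sum_congr rfl (fun s _ => mul_comm _ _)
  obtain ⟨s₀, -, hs₀⟩ := Finset.exists_max_image (Finset.univ : Finset (Fin P → Bool))
    (fun s => ‖C s‖) ⟨fun _ => true, by simp⟩
  have hCpos : 0 < ‖C s₀‖ := by
    obtain ⟨s, hs⟩ := Function.ne_iff.1 hC0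
    exact (norm_pos_iff.2 hs).trans_le (hs₀ s (by simp))
  refine ⟨s₀, ?_⟩
  intro f z hz hδH
  by_contra hcon
  push Not at hcon
  obtain ⟨hd1, hd2⟩ := pattern_dom P hP (fun i => H f i z) (fun i => G f i z) s₀ hcon
  have hΦn : ∀ s z, ‖Φ f s z‖ = ∏ i, ‖H f i z + (sgn (s i) : ℂ) * G f i z‖ ^ P := by
    intro s z
    simp only [hΦ, norm_prod, norm_pow]
  simp_rw [← hΦn] at hd1 hd2
  -- upper bound
  have hup := hsmall (fun z => ∑ s, C s * Φ f s z) (2 ^ P * ‖C s₀‖ * X ^ (P * P))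
    (by
      intro z hz j
      apply DifferentiableOn.fun_sum
      intro s _
      apply DifferentiableOn.const_mul
      simp only [hΦ]
      apply DifferentiableOn.fun_finsetProd
      intro i _
      exact ((hHd f i z hz j).add ((hGd f i z hz j).const_mul _)).pow P)
    (by
      intro z hz
      refine (norm_sum_le _ _).trans ?_
      calc _ ≤ ∑ s : Fin P → Bool, ‖C s₀‖ * X ^ (P * P) := by
            apply Finset.sum_le_sum
            intro s _
            rw [norm_mul]
            gcongr
            · exact hs₀ s (by simp)
            · rw [hΦn]
              calc _ ≤ ∏ i : Fin P, X ^ P := by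
                    apply Finset.prod_le_prod
                    · intro i _; positivity
                    · intro i _
                      gcongr
                      refine (norm_add_le _ _).trans ?_
                      rw [norm_mul, hnorm, one_mul]
                      exact hb f i z hz
                _ = X ^ (P * P) := by simp [pow_mul]
        _ = _ := by simp [mul_assoc])
    (hC f) z hz
  -- lower bound
  have hlow : 2 / 3 * ‖C s₀‖ * ‖Φ f s₀ z‖ ≤ ‖∑ s, C s * Φ f s z‖ := by
    have h1 : ‖∑ s ∈ Finset.univ.erase s₀, C s * Φ f s z‖ ≤ ‖C s₀‖ * (1/3 * ‖Φ f s₀ z‖) := by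
      refine (norm_sum_le _ _).trans ?_
      calc _ ≤ ∑ s ∈ Finset.univ.erase s₀, ‖C s₀‖ * ‖Φ f s z‖ := by
            apply Finset.sum_le_sum
            intro s _
            rw [norm_mul]
            gcongr
            exact hs₀ s (by simp)
        _ = ‖C s₀‖ * ∑ s ∈ Finset.univ.erase s₀, ‖Φ f s z‖ := by rw [Finset.mul_sum]
        _ ≤ _ := by
            gcongr
            have := Finset.add_sum_erase Finset.univ (fun s => ‖Φ f s z‖) (Finset.mem_univ s₀)
            linarith
    have h2 := Finset.add_sum_erase Finset.univ (fun s => C s * Φ f s z) (Finset.mem_univ s₀)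
    have h3 : ‖C s₀ * Φ f s₀ z‖ ≤ ‖∑ s, C s * Φ f s z‖ +
        ‖∑ s ∈ Finset.univ.erase s₀, C s * Φ f s z‖ := by
      rw [← h2]
      simpa using norm_sub_le (C s₀ * Φ f s₀ z + ∑ s ∈ Finset.univ.erase s₀, C s * Φ f s z)
        (∑ s ∈ Finset.univ.erase s₀, C s * Φ f s z)
    rw [norm_mul] at h3
    linarith
  have hΦlow : δ ^ (P * P) ≤ ‖Φ f s₀ z‖ := by
    refine le_trans ?_ hd1
    calc δ ^ (P * P) = ∏ i : Fin P, δ ^ P := by simp [pow_mul]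
      _ ≤ _ := by
        apply Finset.prod_le_prod
        · intro i _; positivity
        · intro i _
          gcongr
          exact hδH i
  have h1 : 2 / 3 * ‖C s₀‖ * δ ^ (P * P) ≤ 2 / 3 * ‖C s₀‖ * ‖Φ f s₀ z‖ := by gcongr
  have h2 := h1.trans (hlow.trans hup)
  have h3 := mul_lt_mul_of_pos_left hnum hCpos
  have h4 : 0 < ‖C s₀‖ * δ ^ (P * P) := by positivity
  nlinarith

/-- Choice of the constant `D`. -/
lemma exists_D (a₃ : ℝ) (c : ℕ) : ∃ D : ℕ, 6 + c ≤ D ∧ 1 ≤ D ∧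
    a₃ * (D:ℝ) ^ 3 * 2 ^ (6 + c) < 2 ^ D := by
  have h := tendsto_pow_const_div_const_pow_of_one_lt 3 (r := (2:ℝ)) (by norm_num)
  have h2 := h.const_mul (a₃ * 2 ^ (6 + c))
  rw [mul_zero] at h2
  have h3 := (h2.eventually (gt_mem_nhds (zero_lt_one))).and
    (Filter.eventually_ge_atTop (6 + c))
  obtain ⟨D, hD1, hD2⟩ := h3.exists
  refine ⟨D, hD2, by omega, ?_⟩
  rw [← mul_div_assoc, div_lt_one (by positivity)] at hD1
  linarith

lemma clog_facts (n : ℕ) (hn : 2 ≤ n) : 1 ≤ Nat.clog 2 n ∧ n ≤ 2 ^ Nat.clog 2 n ∧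
    (Nat.clog 2 n : ℝ) ≤ 3 * Real.log n := by
  have h1 : 1 ≤ Nat.clog 2 n := Nat.clog_pos (by norm_num) hn
  refine ⟨h1, Nat.le_pow_clog (by norm_num) n, ?_⟩
  have h2 : 2 ^ (Nat.clog 2 n).pred < n := Nat.pow_pred_clog_lt_self (by norm_num) (by omega)
  have h3 : (2:ℝ) ^ (Nat.clog 2 n - 1) ≤ n := by exact_mod_cast h2.le
  have h4 := Real.log_le_log (by positivity) h3
  rw [Real.log_pow, Nat.cast_sub h1] at h4
  have h5 : Real.log 2 ≤ Real.log n := Real.log_le_log (by norm_num) (by exact_mod_cast hn)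
  have := Real.log_two_gt_d9
  push_cast at h4
  have h6 : (Nat.clog 2 n : ℝ) * Real.log 2 ≤ 2 * Real.log n := by linarith
  have h7 : (0:ℝ) ≤ Nat.clog 2 n := by positivity
  have h8 : (0:ℝ) ≤ Real.log n := by linarith
  nlinarith

/-- The numerical choice of `P` and `T`. -/
lemma numerics (q : ℝ) (hq0 : 0 < q) (hq1 : q < 1) (a : ℝ) (ha : 0 ≤ a) (c : ℕ) :
    ∃ D : ℕ, 1 ≤ D ∧ ∀ n : ℕ, 2 ≤ n → ∃ P T : ℕ, 0 < P ∧ 0 < T ∧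
      (P:ℝ) ≤ 3 * D * (n * Real.log n) ∧ 2 * T ^ n < 2 ^ P ∧ (T + 1) ^ n ≤ 2 ^ P ∧
      2 * 2 ^ P * Real.exp (a * P * n ^ c) ^ (P * P) * (2 * q ^ T / (1 - q)) * 2 ^ P < 1 := by
  have h1q : 0 < 1 - q := by linarith
  set lam := -Real.log q with hlam
  have hlam0 : 0 < lam := by rw [hlam]; linarith [Real.log_neg hq0 hq1]
  set a₂ := a + 2 + 4 / (1 - q) with ha₂
  have ha₂0 : 0 < a₂ := by positivity
  obtain ⟨D, hD1, hD2, hD3⟩ := exists_D (2 * a₂ / lam) c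
  refine ⟨D, hD2, ?_⟩
  intro n hn
  obtain ⟨hl1, hl2, hl3⟩ := clog_facts n hn
  set l := Nat.clog 2 n with hl
  have hDl : 1 ≤ D * l := Nat.one_le_iff_ne_zero.2 (by positivity)
  refine ⟨n * (D * l), 2 ^ (D * l - 1), by positivity, by positivity, ?_, ?_, ?_, ?_⟩
  · push_cast
    calc (n:ℝ) * (D * l) ≤ n * (D * (3 * Real.log n)) := by gcongr
      _ = _ := by ring
  · rw [← pow_mul, ← pow_succ']
    apply Nat.pow_lt_pow_right (by norm_num)
    obtain ⟨k, hk⟩ : ∃ k, D * l = k + 1 := ⟨D * l - 1, by omega⟩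
    rw [hk]
    simp only [Nat.add_sub_cancel]
    nlinarith
  · calc (2 ^ (D * l - 1) + 1) ^ n ≤ (2 ^ (D * l)) ^ n := by
          gcongr
          obtain ⟨k, hk⟩ : ∃ k, D * l = k + 1 := ⟨D * l - 1, by omega⟩
          rw [hk, pow_succ]
          simp only [Nat.add_sub_cancel]
          have : 1 ≤ 2 ^ k := Nat.one_le_two_pow
          omega
      _ = _ := by rw [← pow_mul, mul_comm]
  · set P := n * (D * l) with hP
    set T := 2 ^ (D * l - 1) with hT
    have hP1 : (1:ℝ) ≤ P := by
      have : 1 ≤ P := by rw [hP]; exact Nat.one_le_iff_ne_zero.2 (by positivity)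
      exact_mod_cast this
    have hn1 : (1:ℝ) ≤ (n:ℝ) ^ c := one_le_pow₀ (by exact_mod_cast (by omega : 1 ≤ n))
    -- T is large
    have hTbig : a₂ * ((P:ℝ) ^ 3 * n ^ c) < T * lam := by
      have e1 : (2:ℝ) * T = 2 ^ (D * l) := by
        rw [hT]; push_cast
        rw [← pow_succ']; congr 1; omega
      have e2 : (P:ℝ) ^ 3 * n ^ c ≤ D ^ 3 * 2 ^ (l * (6 + c)) := by
        rw [hP]; push_cast
        have e3 : (n:ℝ) ≤ 2 ^ l := by exact_mod_cast hl2
        have e4 : (l:ℝ) ≤ 2 ^ l := by exact_mod_cast (Nat.lt_two_pow_self (n := l)).le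
        calc ((n:ℝ) * ((D:ℝ) * (l:ℝ))) ^ 3 * (n:ℝ) ^ c
            ≤ ((2:ℝ) ^ l * ((D:ℝ) * (2:ℝ) ^ l)) ^ 3 * ((2:ℝ) ^ l) ^ c := by gcongr
          _ = (D:ℝ) ^ 3 * (2:ℝ) ^ (l * (6 + c)) := by
              rw [pow_mul]; ring
      have e5 : 2 * a₂ / lam * (D:ℝ) ^ 3 * 2 ^ (l * (6 + c)) < 2 ^ (D * l) := by
        obtain ⟨k, hk⟩ : ∃ k, l = k + 1 := ⟨l - 1, by omega⟩
        have e6 : (2:ℝ) ^ (l * (6 + c)) = 2 ^ (6 + c) * 2 ^ (k * (6 + c)) := by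
          rw [← pow_add, hk]; congr 1; ring
        have e7 : (2:ℝ) ^ (D * l) = 2 ^ D * 2 ^ (k * D) := by
          rw [← pow_add, hk]; congr 1; ring
        rw [e6, e7]
        have e8 : (2:ℝ) ^ (k * (6 + c)) ≤ 2 ^ (k * D) := by
          apply pow_le_pow_right₀ (by norm_num)
          gcongr
        calc _ = (2 * a₂ / lam * (D:ℝ) ^ 3 * 2 ^ (6 + c)) * 2 ^ (k * (6 + c)) := by ring
          _ ≤ (2 * a₂ / lam * (D:ℝ) ^ 3 * 2 ^ (6 + c)) * 2 ^ (k * D) := by gcongr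
          _ < _ := by gcongr
      calc a₂ * ((P:ℝ) ^ 3 * n ^ c) ≤ a₂ * (D ^ 3 * 2 ^ (l * (6 + c))) := by gcongr
        _ = (2 * a₂ / lam * (D:ℝ) ^ 3 * 2 ^ (l * (6 + c))) * (lam / 2) := by field_simp
        _ < 2 ^ (D * l) * (lam / 2) := by gcongr
        _ = T * lam := by rw [← e1]; ring
    have f1 : q ^ T = Real.exp (-(T * lam)) := by
      rw [hlam, mul_neg, neg_neg, Real.exp_nat_mul, Real.exp_log hq0]
    have f2 : Real.exp (a * P * n ^ c) ^ (P * P) = Real.exp (a * (P ^ 3 * n ^ c)) := by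
      rw [← Real.exp_nat_mul]; congr 1; push_cast; ring
    have f3 : (2:ℝ) ^ P ≤ Real.exp P := by
      have := Real.add_one_le_exp (1:ℝ)
      calc (2:ℝ) ^ P ≤ Real.exp 1 ^ P := by gcongr; linarith
        _ = Real.exp P := by rw [← Real.exp_nat_mul]; simp
    have f4 : 4 / (1 - q) ≤ Real.exp (4 / (1 - q)) := by
      linarith [Real.add_one_le_exp (4 / (1 - q))]
    have f5 : (P:ℝ) ≤ P ^ 3 * n ^ c := by
      calc (P:ℝ) = P ^ 1 * 1 := by ring
        _ ≤ P ^ 3 * n ^ c := by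
          gcongr
          norm_num
    have f6 : (1:ℝ) ≤ P ^ 3 * n ^ c := hP1.trans f5
    have f7 : 0 < 4 / (1 - q) := by positivity
    calc 2 * 2 ^ P * Real.exp (a * P * n ^ c) ^ (P * P) * (2 * q ^ T / (1 - q)) * 2 ^ P
        = (4 / (1 - q)) * 2 ^ P * 2 ^ P * Real.exp (a * P * n ^ c) ^ (P * P) * q ^ T := by ring
      _ ≤ Real.exp (4 / (1 - q)) * Real.exp P * Real.exp P * Real.exp (a * (P ^ 3 * n ^ c)) *
          Real.exp (-(T * lam)) := by
          rw [f2, f1]; gcongr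
      _ = Real.exp (4 / (1 - q) + P + P + a * (P ^ 3 * n ^ c) + (-(T * lam))) := by
          simp only [Real.exp_add]
      _ < 1 := by
          rw [Real.exp_lt_one_iff]
          rw [ha₂] at hTbig
          nlinarith

/-- Counting argument plus numerics: for the right number `P` of test points, one sign pattern
cannot be realized by either of the two families. -/
lemma middle (L κ q a : ℝ) (hL : 0 < L) (hκ0 : 0 < κ) (hκ1 : κ ≤ 1) (hq0 : 0 < q) (hq1 : q < 1)
    (ha : 0 ≤ a) (c : ℕ) :
    ∃ C' : ℝ, 0 < C' ∧ ∀ n : ℕ, 2 ≤ n → ∃ P : ℕ, 0 < P ∧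
      C' / ((n:ℝ) ^ L * Real.log n ^ L) ≤ κ * (P:ℝ) ^ (-L) / 10 ∧
      ∀ (ι : Type) [Fintype ι] [DecidableEq ι], Fintype.card ι = n →
      ∀ (cen : ι → ℂ) (ρ : ι → ℝ), (∀ j, 0 < ρ j) →
      ∀ (Num Den : Bool → Fin P → (ι → ℂ) → ℂ),
      (∀ f i, ∀ z : ι → ℂ, (∀ j, z j ∈ Metric.closedBall (cen j) (ρ j / q)) → ∀ j,
          DifferentiableOn ℂ (fun t => Num f i (Function.update z j t))
            (Metric.closedBall (cen j) (ρ j / q))) →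
      (∀ f i, ∀ z : ι → ℂ, (∀ j, z j ∈ Metric.closedBall (cen j) (ρ j / q)) → ∀ j,
          DifferentiableOn ℂ (fun t => Den f i (Function.update z j t))
            (Metric.closedBall (cen j) (ρ j / q))) →
      (∀ f i, ∀ z : ι → ℂ, (∀ j, z j ∈ Metric.closedBall (cen j) (ρ j / q)) →
        ‖Num f i z‖ ≤ Real.exp (a * n ^ c) ∧ ‖Den f i z‖ ≤ Real.exp (a * n ^ c)) →
      ∀ g : Fin P → ℝ, (∀ i, |g i| ≤ 1) →
      ∃ s : Fin P → Bool, ∀ f, ∀ z : ι → ℂ, (∀ j, z j ∈ Metric.closedBall (cen j) (ρ j)) →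
        (∀ i, Real.exp (-(a * n ^ c)) ≤ ‖Den f i z‖) →
        ∃ i, κ * (P:ℝ) ^ (-L) / 10 <
          ‖((g i + sgn (s i) * (κ * (P:ℝ) ^ (-L)) : ℝ) : ℂ) - Num f i z / Den f i z‖ := by
  obtain ⟨D, hD, hnum⟩ := numerics q hq0 hq1 (2 * a + 2 + L + 1 / κ) (by positivity) c
  have hD0 : (0:ℝ) < D := by exact_mod_cast hD
  refine ⟨κ * (3 * D) ^ (-L) / 10, by positivity, ?_⟩
  intro n hn
  obtain ⟨P, T, hP, hT, hPle, hTP, hT1, hmain⟩ := hnum n hn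
  have hn0 : (0:ℝ) < n := by exact_mod_cast (by omega : 0 < n)
  have hlog : 0 < Real.log n := Real.log_pos (by exact_mod_cast (by omega : 1 < n))
  have hP0 : (0:ℝ) < P := by exact_mod_cast hP
  have hP1 : (1:ℝ) ≤ P := by exact_mod_cast hP
  refine ⟨P, hP, ?_, ?_⟩
  · have h1 : (3 * D * (n * Real.log n)) ^ (-L) ≤ (P:ℝ) ^ (-L) :=
      Real.rpow_le_rpow_of_nonpos hP0 hPle (by linarith)
    calc κ * (3 * D) ^ (-L) / 10 / ((n:ℝ) ^ L * Real.log n ^ L)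
        = κ * (3 * D * (n * Real.log n)) ^ (-L) / 10 := by
          rw [Real.mul_rpow (x := 3 * (D:ℝ)) (y := n * Real.log n) (by positivity) (by positivity),
            Real.rpow_neg (x := n * Real.log n)
            (by positivity), Real.mul_rpow hn0.le hlog.le]
          field_simp
      _ ≤ _ := by gcongr
  · intro ι _ _ hcard cen ρ hρ Num Den hNd hDd hb g hg
    set Y : ℝ := (n:ℝ) ^ c with hY
    have hY1 : 1 ≤ Y := one_le_pow₀ (by exact_mod_cast (by omega : 1 ≤ n))
    set τ : ℝ := κ * (P:ℝ) ^ (-L) with hτ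
    have hτ0 : 0 < τ := by positivity
    have hPL : (P:ℝ) ^ (-L) ≤ 1 := Real.rpow_le_one_of_one_le_of_nonpos hP1 (by linarith)
    have hτ1 : τ ≤ 1 := by
      have : 0 < (P:ℝ) ^ (-L) := by positivity
      nlinarith
    have hXδ : 3 * Real.exp (a * Y) ≤ (τ * Real.exp (-(a * Y))) *
        Real.exp ((2 * a + 2 + L + 1 / κ) * P * Y) := by
      have g1 : (3:ℝ) ≤ Real.exp 2 := by linarith [Real.add_one_le_exp (2:ℝ)]
      have g2 : 1 ≤ κ * Real.exp (1 / κ) := by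
        have := Real.add_one_le_exp (1 / κ)
        calc 1 = κ * (1 / κ) := by field_simp
          _ ≤ _ := by gcongr; linarith
      have g3 : 1 ≤ (P:ℝ) ^ (-L) * Real.exp (L * P) := by
        rw [Real.rpow_def_of_pos hP0, ← Real.exp_add]
        apply Real.one_le_exp
        have := Real.log_le_sub_one_of_pos hP0
        nlinarith
      have g4 : Real.exp (2 * a * Y + 2 + L * P + 1 / κ) ≤
          Real.exp ((2 * a + 2 + L + 1 / κ) * P * Y) := by
        apply Real.exp_le_exp.2
        have k1 : 1 ≤ P * Y := by nlinarith
        have k2 : Y ≤ P * Y := by nlinarith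
        have k3 : (P:ℝ) ≤ P * Y := by nlinarith
        have k4 : 0 < 1 / κ := by positivity
        have k5 : a * Y ≤ a * (P * Y) := by gcongr
        have k6 : L * P ≤ L * (P * Y) := by gcongr
        have k7 : 1 / κ * 1 ≤ 1 / κ * (P * Y) := by gcongr
        linarith
      calc 3 * Real.exp (a * Y) ≤ Real.exp 2 * Real.exp (a * Y) * 1 * 1 := by
            simp only [mul_one]; gcongr
        _ ≤ Real.exp 2 * Real.exp (a * Y) * (κ * Real.exp (1 / κ)) *
            ((P:ℝ) ^ (-L) * Real.exp (L * P)) := by gcongr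
        _ = (τ * Real.exp (-(a * Y))) * Real.exp (2 * a * Y + 2 + L * P + 1 / κ) := by
            have k8 : Real.exp (a * Y) = Real.exp (-(a * Y)) * Real.exp (2 * a * Y) := by
              rw [← Real.exp_add]; congr 1; ring
            rw [k8, hτ]
            simp only [Real.exp_add]
            ring
        _ ≤ _ := by gcongr
    have h1q : 0 < 1 - q := by linarith
    obtain ⟨s, hs⟩ := core cen ρ q hq0 hq1 hρ T P hT hP (by rw [hcard]; exact hTP)
      (3 * Real.exp (a * Y)) (τ * Real.exp (-(a * Y))) (by positivity) (by positivity)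
      (by
        rw [hcard]
        have k1 : ((T:ℝ) + 1) ^ n ≤ 2 ^ P := by exact_mod_cast hT1
        have k2 : 0 < (τ * Real.exp (-(a * Y))) ^ (P * P) := by positivity
        calc _ ≤ 2 * 2 ^ P * ((τ * Real.exp (-(a * Y))) *
              Real.exp ((2 * a + 2 + L + 1 / κ) * P * Y)) ^ (P * P) * (2 * q ^ T / (1 - q)) *
                2 ^ P := by gcongr
          _ = (τ * Real.exp (-(a * Y))) ^ (P * P) *
              (2 * 2 ^ P * Real.exp ((2 * a + 2 + L + 1 / κ) * P * Y) ^ (P * P) *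
              (2 * q ^ T / (1 - q)) * 2 ^ P) := by
                rw [mul_pow (τ * Real.exp (-(a * Y)))]; ring
          _ < (τ * Real.exp (-(a * Y))) ^ (P * P) * 1 := by gcongr
          _ = _ := mul_one _)
      (fun f i z => (τ:ℂ) * Den f i z) (fun f i z => Num f i z - (g i : ℂ) * Den f i z)
      (fun f i z hz j => (hDd f i z hz j).const_mul _)
      (fun f i z hz j => (hNd f i z hz j).sub ((hDd f i z hz j).const_mul _))
      (by
        intro f i z hz
        obtain ⟨k1, k2⟩ := hb f i z hz
        have k3 : ‖(τ:ℂ) * Den f i z‖ ≤ 1 * Real.exp (a * Y) := by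
          rw [norm_mul, Complex.norm_real, Real.norm_eq_abs, abs_of_pos hτ0]
          gcongr
        have k4 : ‖(g i : ℂ) * Den f i z‖ ≤ 1 * Real.exp (a * Y) := by
          rw [norm_mul, Complex.norm_real, Real.norm_eq_abs]
          gcongr
          exact hg i
        have k5 := norm_sub_le (Num f i z) ((g i : ℂ) * Den f i z)
        linarith)
    refine ⟨s, ?_⟩
    intro f z hz hden
    have hτn : ∀ i, ‖(τ:ℂ) * Den f i z‖ = τ * ‖Den f i z‖ := by
      intro i
      rw [norm_mul, Complex.norm_real, Real.norm_eq_abs, abs_of_pos hτ0]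
    obtain ⟨i, hi⟩ := hs f z hz (by
      intro i
      rw [hτn]
      exact mul_le_mul_of_nonneg_left (hden i) hτ0.le)
    refine ⟨i, ?_⟩
    rw [hτn] at hi
    have hDpos : 0 < ‖Den f i z‖ := (Real.exp_pos _).trans_le (hden i)
    have hDne : Den f i z ≠ 0 := norm_pos_iff.1 hDpos
    have e1 : Num f i z - (g i : ℂ) * Den f i z - (sgn (s i) : ℂ) * ((τ:ℂ) * Den f i z) =
        -(((g i + sgn (s i) * τ : ℝ) : ℂ) - Num f i z / Den f i z) * Den f i z := by
      push_cast
      field_simp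
      ring
    rw [e1, norm_mul, norm_neg] at hi
    have e2 : τ / 10 * ‖Den f i z‖ < ‖((g i + sgn (s i) * τ : ℝ) : ℂ) - Num f i z / Den f i z‖ *
        ‖Den f i z‖ := by linarith
    exact lt_of_mul_lt_mul_right e2 hDpos.le

lemma growth_aux (f f' : ℝ → ℂ) (K a b : ℝ) (hab : a ≤ b) (hc : ContinuousOn f (Icc a b))
    (hd : ∀ x ∈ Ioo a b, HasDerivAt f (f' x) x)
    (hK : ∀ x ∈ Ioo a b, ‖f' x‖ ≤ K * ‖f x‖) :
    ‖f a‖ ≤ Real.exp (K * (b - a)) * ‖f b‖ ∧ ‖f b‖ ≤ Real.exp (K * (b - a)) * ‖f a‖ := by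
  have hder : ∀ σ : ℝ, ∀ x ∈ Ioo a b, HasDerivAt (fun x => Real.exp (2 * σ * x) * ‖f x‖ ^ 2)
      (Real.exp (2 * σ * x) * (2 * σ * ‖f x‖ ^ 2 + 2 * inner ℝ (f x) (f' x))) x := by
    intro σ x hx
    have h1 := (hd x hx).norm_sq
    have h2 : HasDerivAt (fun x : ℝ => Real.exp (2 * σ * x)) (Real.exp (2 * σ * x) * (2 * σ)) x := by
      have := ((hasDerivAt_id x).const_mul (2 * σ)).exp
      simpa using this
    have h3 := h2.mul h1
    have e : Real.exp (2 * σ * x) * (2 * σ * ‖f x‖ ^ 2 + 2 * inner ℝ (f x) (f' x)) =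
      Real.exp (2 * σ * x) * (2 * σ) * ‖f x‖ ^ 2 + Real.exp (2 * σ * x) *
        (2 * inner ℝ (f x) (f' x)) := by ring
    rw [e]
    exact h3
  have hcont : ∀ σ : ℝ, ContinuousOn (fun x => Real.exp (2 * σ * x) * ‖f x‖ ^ 2) (Icc a b) := by
    intro σ
    apply ContinuousOn.mul
    · fun_prop
    · exact hc.norm.pow 2
  have hin : ∀ x ∈ Ioo a b, |inner ℝ (f x) (f' x)| ≤ K * ‖f x‖ ^ 2 := by
    intro x hx
    have := abs_real_inner_le_norm (f x) (f' x)
    nlinarith [hK x hx, norm_nonneg (f x)]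
  have hmono : MonotoneOn (fun x => Real.exp (2 * K * x) * ‖f x‖ ^ 2) (Icc a b) := by
    apply monotoneOn_of_deriv_nonneg (convex_Icc a b) (hcont K)
    · rw [interior_Icc]
      intro x hx
      exact (hder K x hx).differentiableAt.differentiableWithinAt
    · rw [interior_Icc]
      intro x hx
      rw [(hder K x hx).deriv]
      have := abs_le.1 (hin x hx)
      apply mul_nonneg (Real.exp_pos _).le
      linarith
  have hanti : AntitoneOn (fun x => Real.exp (2 * (-K) * x) * ‖f x‖ ^ 2) (Icc a b) := by
    apply antitoneOn_of_deriv_nonpos (convex_Icc a b) (hcont (-K))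
    · rw [interior_Icc]
      intro x hx
      exact (hder (-K) x hx).differentiableAt.differentiableWithinAt
    · rw [interior_Icc]
      intro x hx
      rw [(hder (-K) x hx).deriv]
      have := abs_le.1 (hin x hx)
      apply mul_nonpos_of_nonneg_of_nonpos (Real.exp_pos _).le
      linarith
  have h1 := hmono (left_mem_Icc.2 hab) (right_mem_Icc.2 hab) hab
  have h2 := hanti (left_mem_Icc.2 hab) (right_mem_Icc.2 hab) hab
  simp only at h1 h2
  constructor
  · refine (sq_le_sq₀ (norm_nonneg _) (by positivity)).1 ?_
    rw [mul_pow, ← Real.exp_nat_mul]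
    calc ‖f a‖ ^ 2 = Real.exp (-(2 * K * a)) * (Real.exp (2 * K * a) * ‖f a‖ ^ 2) := by
          rw [← mul_assoc, ← Real.exp_add]; simp
      _ ≤ Real.exp (-(2 * K * a)) * (Real.exp (2 * K * b) * ‖f b‖ ^ 2) := by gcongr
      _ = _ := by rw [← mul_assoc, ← Real.exp_add]; congr 2; push_cast; ring
  · refine (sq_le_sq₀ (norm_nonneg _) (by positivity)).1 ?_
    rw [mul_pow, ← Real.exp_nat_mul]
    calc ‖f b‖ ^ 2 = Real.exp (2 * K * b) * (Real.exp (2 * (-K) * b) * ‖f b‖ ^ 2) := by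
          rw [← mul_assoc, ← Real.exp_add]; simp
      _ ≤ Real.exp (2 * K * b) * (Real.exp (2 * (-K) * a) * ‖f a‖ ^ 2) := by gcongr
      _ = _ := by rw [← mul_assoc, ← Real.exp_add]; congr 2; push_cast; ring

lemma growth_Icc01 (f f' : ℝ → ℂ)
    (hder : ∀ x ∈ Icc (0:ℝ) 1, HasDerivWithinAt f (f' x) (Icc 0 1) x) (K a b : ℝ) (ha : 0 ≤ a)
    (hab : a ≤ b) (hb : b ≤ 1)
    (hK : ∀ x ∈ Ioo a b, ‖f' x‖ ≤ K * ‖f x‖) :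
    ‖f a‖ ≤ Real.exp (K * (b - a)) * ‖f b‖ ∧ ‖f b‖ ≤ Real.exp (K * (b - a)) * ‖f a‖ := by
  apply growth_aux f f' K a b hab _ _ hK
  · intro x hx
    exact ((hder x ⟨ha.trans hx.1, hx.2.trans hb⟩).continuousWithinAt).mono
      (Icc_subset_Icc ha hb)
  · intro x hx
    exact (hder x ⟨ha.trans hx.1.le, hx.2.le.trans hb⟩).hasDerivAt
      (Icc_mem_nhds (ha.trans_lt hx.1) (hx.2.trans_le hb))

lemma nonvan (f f' : ℝ → ℂ)
    (hder : ∀ x ∈ Icc (0:ℝ) 1, HasDerivWithinAt f (f' x) (Icc 0 1) x) (K : ℝ) (hK0 : 0 ≤ K)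
    (h0 : f 0 ≠ 0)
    (h : ∀ y ∈ Icc (0:ℝ) 1, (∀ x ∈ Icc 0 y, f x ≠ 0) → ‖f' y‖ ≤ K * ‖f y‖) :
    ∀ x ∈ Icc (0:ℝ) 1, ‖f 0‖ ≤ Real.exp K * ‖f x‖ := by
  have hcont : ContinuousOn f (Icc 0 1) := fun x hx => (hder x hx).continuousWithinAt
  have hnz : ∀ x ∈ Icc (0:ℝ) 1, f x ≠ 0 := by
    by_contra hcon
    push Not at hcon
    obtain ⟨x₁, hx₁, hfx₁⟩ := hcon
    have hcomp : IsCompact (Icc (0:ℝ) 1 ∩ f ⁻¹' {0}) :=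
      isCompact_Icc.of_isClosed_subset
        (hcont.preimage_isClosed_of_isClosed isClosed_Icc isClosed_singleton) inter_subset_left
    obtain ⟨x₀, hx₀, hmin⟩ := hcomp.exists_isLeast ⟨x₁, hx₁, hfx₁⟩
    have hg := (growth_Icc01 f f' hder K 0 x₀ le_rfl hx₀.1.1 hx₀.1.2 (by
      intro x hx
      apply h x ⟨hx.1.le, hx.2.le.trans hx₀.1.2⟩
      intro y hy hfy
      have := hmin ⟨⟨hy.1, hy.2.trans (hx.2.le.trans hx₀.1.2)⟩, hfy⟩
      linarith [hy.2, hx.2])).1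
    have : f x₀ = 0 := hx₀.2
    rw [this, norm_zero, mul_zero] at hg
    exact h0 (norm_le_zero_iff.1 hg)
  intro x hx
  have hg := (growth_Icc01 f f' hder K 0 x le_rfl hx.1 hx.2 (by
      intro y hy
      apply h y ⟨hy.1.le, hy.2.le.trans hx.2⟩
      intro y' hy'
      exact hnz y' ⟨hy'.1, hy'.2.trans (hy.2.le.trans hx.2)⟩)).1
  refine hg.trans ?_
  gcongr
  nlinarith [hx.2]

lemma van (f f' : ℝ → ℂ)
    (hder : ∀ x ∈ Icc (0:ℝ) 1, HasDerivWithinAt f (f' x) (Icc 0 1) x) (h0 : f 0 = 0)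
    (h : ∀ x₁ ∈ Icc (0:ℝ) 1, ∃ K, ∀ y ∈ Icc 0 x₁, (∀ x ∈ Icc y x₁, f x ≠ 0) →
      ‖f' y‖ ≤ K * ‖f y‖) :
    ∀ x ∈ Icc (0:ℝ) 1, f x = 0 := by
  have hcont : ContinuousOn f (Icc 0 1) := fun x hx => (hder x hx).continuousWithinAt
  intro x₁ hx₁
  by_contra hfx₁
  obtain ⟨K, hK⟩ := h x₁ hx₁
  have hcomp : IsCompact (Icc (0:ℝ) x₁ ∩ f ⁻¹' {0}) :=
      isCompact_Icc.of_isClosed_subset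
        ((hcont.mono (Icc_subset_Icc le_rfl hx₁.2)).preimage_isClosed_of_isClosed isClosed_Icc
          isClosed_singleton) inter_subset_left
  obtain ⟨x₀, hx₀, hmax⟩ := hcomp.exists_isGreatest ⟨0, ⟨le_rfl, hx₁.1⟩, h0⟩
  have hg := (growth_Icc01 f f' hder K x₀ x₁ hx₀.1.1 hx₀.1.2 hx₁.2 (by
      intro x hx
      apply hK x ⟨hx₀.1.1.trans hx.1.le, hx.2.le⟩
      intro y hy hfy
      have := hmax ⟨⟨(hx₀.1.1.trans hx.1.le).trans hy.1, hy.2⟩, hfy⟩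
      linarith [hy.1, hx.1])).2
  have : f x₀ = 0 := hx₀.2
  rw [this, norm_zero, mul_zero] at hg
  exact hfx₁ (norm_le_zero_iff.1 hg)

/-- First-order dichotomy. -/
lemma dich1 (f f' : ℝ → ℂ)
    (hder : ∀ x ∈ Icc (0:ℝ) 1, HasDerivWithinAt f (f' x) (Icc 0 1) x) (K : ℝ) (hK0 : 0 ≤ K)
    (h : ∀ x ∈ Icc (0:ℝ) 1, ‖f' x / f x‖ ≤ K) :
    (f 0 ≠ 0 → ∀ x ∈ Icc (0:ℝ) 1, ‖f 0‖ ≤ Real.exp K * ‖f x‖) ∧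
    (f 0 = 0 → ∀ x ∈ Icc (0:ℝ) 1, f x = 0) := by
  have hb : ∀ x ∈ Icc (0:ℝ) 1, f x ≠ 0 → ‖f' x‖ ≤ K * ‖f x‖ := by
    intro x hx hf
    have := h x hx
    rwa [norm_div, div_le_iff₀ (norm_pos_iff.2 hf)] at this
  constructor
  · intro h0
    apply nonvan f f' hder K hK0 h0
    intro y hy hnz
    exact hb y hy (hnz y ⟨hy.1, le_rfl⟩)
  · intro h0
    apply van f f' hder h0
    intro x₁ hx₁
    refine ⟨K, ?_⟩
    intro y hy hnz
    exact hb y ⟨hy.1, hy.2.trans hx₁.2⟩ (hnz y ⟨le_rfl, hy.2⟩)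

/-- Second-order dichotomy. -/
lemma dich2 (f f' f'' : ℝ → ℂ)
    (hder : ∀ x ∈ Icc (0:ℝ) 1, HasDerivWithinAt f (f' x) (Icc 0 1) x)
    (hder' : ∀ x ∈ Icc (0:ℝ) 1, HasDerivWithinAt f' (f'' x) (Icc 0 1) x)
    (h0' : f' 0 = 0) (K : ℝ) (hK0 : 0 ≤ K)
    (h : ∀ x ∈ Icc (0:ℝ) 1, ‖(f'' x * f x - f' x ^ 2) / f x ^ 2‖ ≤ K) :
    (f 0 ≠ 0 → ∀ x ∈ Icc (0:ℝ) 1, ‖f 0‖ ≤ Real.exp K * ‖f x‖) ∧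
    (f 0 = 0 → ∀ x ∈ Icc (0:ℝ) 1, f x = 0) := by
  have hphi : ∀ a b : ℝ, 0 ≤ a → a ≤ b → b ≤ 1 → (∀ x ∈ Icc a b, f x ≠ 0) →
      ‖f' b / f b - f' a / f a‖ ≤ K := by
    intro a b ha hab hb hnz
    have h1 := Convex.norm_image_sub_le_of_norm_hasDerivWithin_le
      (f := fun x => f' x / f x) (f' := fun x => (f'' x * f x - f' x ^ 2) / f x ^ 2)
      (s := Icc a b) (x := a) (y := b) (C := K)
      (by
        intro x hx
        have hx' : x ∈ Icc (0:ℝ) 1 := ⟨ha.trans hx.1, hx.2.trans hb⟩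
        have h2 := ((hder' x hx').div (hder x hx') (hnz x hx)).mono (Icc_subset_Icc ha hb)
        rw [← pow_two (f' x)] at h2
        exact h2)
      (by
        intro x hx
        exact h x ⟨ha.trans hx.1, hx.2.trans hb⟩)
      (convex_Icc a b) (left_mem_Icc.2 hab) (right_mem_Icc.2 hab)
    refine h1.trans ?_
    rw [Real.norm_eq_abs, abs_of_nonneg (by linarith)]
    nlinarith
  have hdiv : ∀ (C : ℝ) y, f y ≠ 0 → ‖f' y / f y‖ ≤ C → ‖f' y‖ ≤ C * ‖f y‖ := by
    intro C y hf hC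
    rwa [norm_div, div_le_iff₀ (norm_pos_iff.2 hf)] at hC
  constructor
  · intro h0
    apply nonvan f f' hder K hK0 h0
    intro y hy hnz
    apply hdiv _ _ (hnz y ⟨hy.1, le_rfl⟩)
    have := hphi 0 y le_rfl hy.1 hy.2 hnz
    simpa [h0'] using this
  · intro h0
    apply van f f' hder h0
    intro x₁ hx₁
    refine ⟨‖f' x₁ / f x₁‖ + K, ?_⟩
    intro y hy hnz
    apply hdiv _ _ (hnz y ⟨le_rfl, hy.2⟩)
    have h1 := hphi y x₁ hy.1 hy.2 hx₁.2 hnz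
    have h2 := norm_sub_norm_le (f' y / f y) (f' x₁ / f x₁)
    rw [norm_sub_rev] at h2
    linarith

/-- The sum of translated bumps. -/
noncomputable def bumpSum (θ : ℝ → ℝ) (P : ℕ) (s : Fin P → ℝ) (y : ℝ) : ℝ :=
  ∑ i : Fin P, s i * θ (y - (i:ℕ))

/-- At most one of the translates is nonzero. -/
lemma bumpSum_bound (θ : ℝ → ℝ) (hsupp : ∀ y, y ∉ Ioo (0:ℝ) 1 → θ y = 0) (B : ℝ)
    (hB : ∀ y, |θ y| ≤ B) (P : ℕ) (s : Fin P → ℝ) (hs : ∀ i, |s i| ≤ 1) (y : ℝ) :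
    |bumpSum θ P s y| ≤ B := by
  have hB0 : 0 ≤ B := (abs_nonneg _).trans (hB 0)
  unfold bumpSum
  by_cases h : ∃ i : Fin P, y - (i:ℕ) ∈ Ioo (0:ℝ) 1
  · obtain ⟨i, hi⟩ := h
    rw [Finset.sum_eq_single i]
    · rw [abs_mul]
      calc |s i| * |θ (y - (i:ℕ))| ≤ 1 * B := by
            gcongr
            · exact hs i
            · exact hB _
        _ = B := one_mul _
    · intro j _ hj
      rw [hsupp, mul_zero]
      intro hj'
      apply hj
      have h1 : (i:ℕ) < (j:ℕ) + 1 := by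
        have : ((i:ℕ):ℝ) < (j:ℕ) + 1 := by linarith [hi.1, hj'.2]
        exact_mod_cast this
      have h2 : (j:ℕ) < (i:ℕ) + 1 := by
        have : ((j:ℕ):ℝ) < (i:ℕ) + 1 := by linarith [hj'.1, hi.2]
        exact_mod_cast this
      apply Fin.ext
      omega
    · simp
  · push Not at h
    rw [Finset.sum_eq_zero]
    · simpa using hB0
    · intro i _
      rw [hsupp _ (h i), mul_zero]

lemma bumpSum_nonpos (θ : ℝ → ℝ) (hsupp : ∀ y, y ∉ Ioo (0:ℝ) 1 → θ y = 0) (P : ℕ)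
    (s : Fin P → ℝ) (y : ℝ) (hy : y ≤ 0) : bumpSum θ P s y = 0 := by
  apply Finset.sum_eq_zero
  intro i _
  rw [hsupp, mul_zero]
  intro h
  have : (0:ℝ) ≤ (i:ℕ) := by positivity
  linarith [h.1]

lemma bumpSum_peak (θ : ℝ → ℝ) (hsupp : ∀ y, y ∉ Ioo (0:ℝ) 1 → θ y = 0) (P : ℕ)
    (s : Fin P → ℝ) (i : Fin P) : bumpSum θ P s ((i:ℕ) + 1 / 2) = s i * θ (1 / 2) := by
  unfold bumpSum
  rw [Finset.sum_eq_single i]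
  · congr 2; ring
  · intro j _ hj
    rw [hsupp, mul_zero]
    intro h
    apply hj
    have h1 : (i:ℕ) < (j:ℕ) + 1 := by
      have : ((i:ℕ):ℝ) < (j:ℕ) + 1 := by linarith [h.2]
      exact_mod_cast this
    have h2 : (j:ℕ) < (i:ℕ) + 1 := by
      have : ((j:ℕ):ℝ) < (i:ℕ) + 1 := by linarith [h.1]
      exact_mod_cast this
    apply Fin.ext
    omega
  · simp

open scoped ContDiff in
lemma bumpSum_contDiff (θ : ℝ → ℝ) (hθ : ContDiff ℝ ∞ θ) (P : ℕ) (s : Fin P → ℝ) :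
    ContDiff ℝ ∞ (bumpSum θ P s) := by
  unfold bumpSum
  fun_prop

open scoped ContDiff in
lemma bumpSum_iteratedDeriv (θ : ℝ → ℝ) (hθ : ContDiff ℝ ∞ θ) (P : ℕ) (s : Fin P → ℝ) (j : ℕ) :
    iteratedDeriv j (bumpSum θ P s) = bumpSum (iteratedDeriv j θ) P s := by
  funext y
  unfold bumpSum
  have hθj : ContDiff ℝ j θ := hθ.of_le (by exact_mod_cast le_top)
  rw [iteratedDeriv_fun_sum]
  · apply Finset.sum_congr rfl
    intro i _
    rw [iteratedDeriv_const_mul_field]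
    congr 1
    exact congrFun (iteratedDeriv_comp_sub_const j θ ((i:ℕ):ℝ)) y
  · intro i _
    fun_prop

/-- The test function. -/
noncomputable def testFun (m : ℕ) (c μ : ℝ) (θ : ℝ → ℝ) (P : ℕ) (s : Fin P → ℝ) (x : ℝ) : ℝ :=
  c * (2 - x ^ (m + 1)) + μ * bumpSum θ P s (2 * P * x - P)

open scoped ContDiff in
lemma testFun_contDiff (m : ℕ) (c μ : ℝ) (θ : ℝ → ℝ) (hθ : ContDiff ℝ ∞ θ) (P : ℕ)
    (s : Fin P → ℝ) : ContDiff ℝ ∞ (testFun m c μ θ P s) := by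
  have := bumpSum_contDiff θ hθ P s
  unfold testFun
  fun_prop

open scoped ContDiff in
lemma testFun_iteratedDeriv (m : ℕ) (c μ : ℝ) (θ : ℝ → ℝ) (hθ : ContDiff ℝ ∞ θ) (P : ℕ)
    (s : Fin P → ℝ) (j : ℕ) (hj : 1 ≤ j) (x : ℝ) :
    iteratedDeriv j (testFun m c μ θ P s) x =
      -c * (((m + 1).descFactorial j : ℝ) * x ^ (m + 1 - j)) +
        μ * ((2 * P) ^ j * bumpSum (iteratedDeriv j θ) P s (2 * P * x - P)) := by
  have hS := bumpSum_contDiff θ hθ P s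
  have hSj : ContDiff ℝ j (bumpSum θ P s) := hS.of_le (by exact_mod_cast le_top)
  have e1 : testFun m c μ θ P s = fun x => (2 * c + -c * x ^ (m + 1)) +
      μ * bumpSum θ P s (2 * P * x - P) := by
    funext x; unfold testFun; ring
  have e2 : iteratedDeriv j (fun x : ℝ => bumpSum θ P s (2 * P * x - P)) x =
      (2 * P) ^ j * bumpSum (iteratedDeriv j θ) P s (2 * P * x - P) := by
    have h1 := iteratedDeriv_comp_const_mul (n := j) (f := fun y => bumpSum θ P s (y - P))
      (by fun_prop) (2 * (P:ℝ))
    have h2 := congrFun h1 x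
    rw [h2, congrFun (iteratedDeriv_comp_sub_const j (bumpSum θ P s) (P:ℝ)) (2 * P * x),
      bumpSum_iteratedDeriv θ hθ]
  rw [e1, iteratedDeriv_fun_add (by fun_prop) (by fun_prop), iteratedDeriv_const_mul_field, e2,
    iteratedDeriv_const_add (by omega), iteratedDeriv_const_mul_field, iteratedDeriv_pow]

open scoped ContDiff in
set_option maxHeartbeats 2000000 in
/-- Existence of the extremal test functions. -/
lemma testFun_props (m : ℕ) (hm : 1 ≤ m) (α : ℝ) (hα0 : 0 < α) (hα1 : α ≤ 1) (θ : ℝ → ℝ)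
    (hθ : ContDiff ℝ ∞ θ) (hts : tsupport θ ⊆ Ioo 0 1) :
    ∃ c κ : ℝ, 0 < c ∧ c ≤ 1 / 4 ∧ 0 < κ ∧ κ ≤ 1 ∧ ∀ P : ℕ, 0 < P → ∀ s : Fin P → ℝ,
      (∀ i, |s i| ≤ 1) →
      let h := testFun m c (κ * (P:ℝ) ^ (-((m:ℝ) + α))) θ P s
      HolderClass1 m α h ∧
        (∀ x ∈ I01, 0 < h x) ∧ StrictAntiOn h I01 ∧
        (∀ j, 1 ≤ j → j ≤ m → iteratedDerivWithin j h I01 0 = 0) := by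
  have hcs : HasCompactSupport θ := by
    apply IsCompact.of_isClosed_subset (isCompact_Icc (a := (0:ℝ)) (b := 1)) (isClosed_tsupport θ)
    exact hts.trans Ioo_subset_Icc_self
  have hcsj : ∀ j, tsupport (iteratedDeriv j θ) ⊆ tsupport θ := by
    intro j
    induction j with
    | zero => simp
    | succ j ih =>
      rw [iteratedDeriv_succ]
      exact tsupport_deriv_subset.trans ih
  have hsj : ∀ j y, y ∉ Ioo (0:ℝ) 1 → iteratedDeriv j θ y = 0 := by
    intro j y hy
    exact image_eq_zero_of_notMem_tsupport (fun h => hy (hts (hcsj j h)))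
  have hbd : ∀ j, ∃ C, ∀ y, |iteratedDeriv j θ y| ≤ C := by
    intro j
    have h1 : HasCompactSupport (iteratedDeriv j θ) :=
      hcs.of_isClosed_subset (isClosed_tsupport _) (hcsj j)
    have h2 : Continuous (iteratedDeriv j θ) := hθ.continuous_iteratedDeriv j (by exact_mod_cast le_top)
    simpa using h1.exists_bound_of_continuous h2
  choose Cb hCb using hbd
  set B : ℝ := 1 + ∑ j ∈ Finset.range (m + 2), Cb j with hBdef
  have hCb0 : ∀ j, 0 ≤ Cb j := fun j => (abs_nonneg _).trans (hCb j 0)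
  have hB : ∀ j ≤ m + 1, ∀ y, |iteratedDeriv j θ y| ≤ B := by
    intro j hj y
    have := Finset.single_le_sum (f := Cb) (fun i _ => hCb0 i)
      (Finset.mem_range.2 (by omega : j < m + 2))
    linarith [hCb j y]
  have hB1 : 1 ≤ B := by
    have := Finset.sum_nonneg (s := Finset.range (m + 2)) (fun i _ => hCb0 i)
    linarith
  set F : ℝ := ((m + 1).factorial : ℝ) with hF
  have hF1 : 1 ≤ F := by
    rw [hF]
    exact_mod_cast Nat.one_le_iff_ne_zero.2 (Nat.factorial_ne_zero _)
  set c : ℝ := 1 / (4 * F) with hc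
  have hc0 : 0 < c := by positivity
  have hcF : c * F = 1 / 4 := by rw [hc]; field_simp
  have hc4 : c ≤ 1 / 4 := by nlinarith
  set κ : ℝ := c / (4 * 2 ^ (m + 2) * B) with hκ
  have hκ0 : 0 < κ := by positivity
  have hκB : κ * (2 ^ (m + 2) * B) = c / 4 := by rw [hκ]; field_simp
  have h2m : (4:ℝ) ≤ 2 ^ (m + 2) := by
    have : (1:ℝ) ≤ 2 ^ m := one_le_pow₀ (by norm_num)
    rw [pow_add]; linarith
  have hκB4 : κ * (4 * B) ≤ c / 4 := by
    rw [← hκB]; gcongr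
  have hκ1 : κ ≤ 1 := by nlinarith
  refine ⟨c, κ, hc0, hc4, hκ0, hκ1, ?_⟩
  intro P hP s hs
  intro h
  have hP1 : (1:ℝ) ≤ P := by exact_mod_cast hP
  have hP0 : (0:ℝ) < P := by linarith
  set μ : ℝ := κ * (P:ℝ) ^ (-((m:ℝ) + α)) with hμ
  have hμ0 : 0 < μ := by positivity
  have hhC : ContDiff ℝ ∞ h := testFun_contDiff m c μ θ hθ P s
  have hhd : ∀ j, 1 ≤ j → ∀ x, iteratedDeriv j h x = -c * (((m + 1).descFactorial j : ℝ) *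
      x ^ (m + 1 - j)) + μ * ((2 * P) ^ j * bumpSum (iteratedDeriv j θ) P s (2 * P * x - P)) :=
    fun j hj x => testFun_iteratedDeriv m c μ θ hθ P s j hj x
  have hU : UniqueDiffOn ℝ I01 := uniqueDiffOn_Icc (by norm_num)
  have hW : ∀ j, ∀ x ∈ I01, iteratedDerivWithin j h I01 x = iteratedDeriv j h x := by
    intro j x hx
    exact iteratedDerivWithin_eq_iteratedDeriv hU
      ((hhC.of_le (by exact_mod_cast le_top)).contDiffAt) hx
  have hSb : ∀ j ≤ m + 1, ∀ y, |bumpSum (iteratedDeriv j θ) P s y| ≤ B := fun j hj y =>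
    bumpSum_bound _ (hsj j) B (hB j hj) P s hs y
  -- `μ (2P)^j ≤ κ 2^m` for `j ≤ m`
  have hμj : ∀ j ≤ m, μ * (2 * (P:ℝ)) ^ j ≤ κ * 2 ^ m := by
    intro j hj
    have h1 : (2 * (P:ℝ)) ^ j ≤ (2 * (P:ℝ)) ^ m := pow_le_pow_right₀ (by linarith) hj
    have h2 : (P:ℝ) ^ (-((m:ℝ) + α)) * (P:ℝ) ^ m ≤ 1 := by
      rw [← Real.rpow_natCast, ← Real.rpow_add hP0]
      apply Real.rpow_le_one_of_one_le_of_nonpos hP1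
      linarith
    calc μ * (2 * (P:ℝ)) ^ j ≤ μ * (2 * (P:ℝ)) ^ m := by gcongr
      _ = κ * 2 ^ m * ((P:ℝ) ^ (-((m:ℝ) + α)) * (P:ℝ) ^ m) := by rw [hμ, mul_pow]; ring
      _ ≤ κ * 2 ^ m * 1 := by gcongr
      _ = _ := mul_one _
  have h2m' : (2:ℝ) ^ (m + 2) = 4 * 2 ^ m := by rw [pow_add]; ring
  have hbj : ∀ j ≤ m, ∀ y, |μ * ((2 * (P:ℝ)) ^ j * bumpSum (iteratedDeriv j θ) P s y)| ≤ c / 16 := by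
    intro j hj y
    rw [← mul_assoc, abs_mul, abs_of_nonneg (by positivity)]
    calc _ ≤ κ * 2 ^ m * B :=
          mul_le_mul (hμj j hj) (hSb j (by omega) y) (abs_nonneg _) (by positivity)
      _ = c / 16 := by rw [h2m'] at hκB; linarith
  have hbase : ∀ j, ∀ x ∈ I01, |-c * (((m + 1).descFactorial j : ℝ) * x ^ (m + 1 - j))| ≤ 1 / 4 := by
    intro j x hx
    have h1 : ((m + 1).descFactorial j : ℝ) ≤ F := by
      rw [hF]
      by_cases hj : j ≤ m + 1
      · have := Nat.factorial_mul_descFactorial hj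
        have h3 : (m + 1).descFactorial j ≤ (m + 1).factorial := by
          rw [← this]; exact Nat.le_mul_of_pos_left _ (Nat.factorial_pos _)
        exact_mod_cast h3
      · rw [Nat.descFactorial_of_lt (by omega)]; simp
    have h2 : x ^ (m + 1 - j) ≤ 1 := pow_le_one₀ hx.1 hx.2
    have h3 : 0 ≤ x ^ (m + 1 - j) := pow_nonneg hx.1 _
    rw [neg_mul, abs_neg, abs_of_nonneg (by positivity)]
    calc _ ≤ c * (F * 1) := by gcongr
      _ = 1 / 4 := by linarith
  have hval : ∀ x ∈ I01, c / 2 ≤ h x ∧ h x ≤ 1 := by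
    intro x hx
    have h1 := abs_le.1 (hbj 0 (by omega) (2 * P * x - P))
    simp only [pow_zero, one_mul, iteratedDeriv_zero] at h1
    have h2 : x ^ (m + 1) ≤ 1 := pow_le_one₀ hx.1 hx.2
    have h3 : 0 ≤ x ^ (m + 1) := pow_nonneg hx.1 _
    have h4 : h x = c * (2 - x ^ (m + 1)) + μ * bumpSum θ P s (2 * P * x - P) := rfl
    rw [h4]
    constructor
    · nlinarith
    · nlinarith
  refine ⟨⟨?_, ?_, ?_⟩, ?_, ?_, ?_⟩
  · exact (hhC.of_le (by exact_mod_cast le_top)).contDiffOn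
  · intro j hj x hx
    rw [hW j x hx]
    rcases Nat.eq_zero_or_pos j with rfl | hj0
    · rw [iteratedDeriv_zero, abs_le]
      obtain ⟨h1, h2⟩ := hval x hx
      constructor <;> linarith
    · rw [hhd j hj0]
      refine (abs_add_le _ _).trans ?_
      have h1 := hbase j x hx
      have h2 := hbj j hj (2 * P * x - P)
      linarith
  · intro x hx y hy
    rw [hW m x hx, hW m y hy, hhd m hm, hhd m hm]
    set r := |x - y| with hr
    have hr0 : 0 ≤ r := abs_nonneg _
    have hr1 : r ≤ 1 := by
      rw [hr, abs_le]; constructor <;> linarith [hx.1, hx.2, hy.1, hy.2]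
    have hrα : r ≤ r ^ α := by
      calc r = r ^ (1:ℝ) := (Real.rpow_one r).symm
        _ ≤ r ^ α := Real.rpow_le_rpow_of_exponent_ge_of_imp hr0 hr1 hα1 (by
            intro _ h; linarith)
    have hd : ((m + 1).descFactorial m : ℝ) = F := by
      rw [hF]
      have := Nat.factorial_mul_descFactorial (Nat.le_succ m)
      simp only [Nat.succ_eq_add_one, Nat.add_sub_cancel_left, Nat.factorial_one, one_mul] at this
      exact_mod_cast this
    have hm1 : m + 1 - m = 1 := by omega
    rw [hd, hm1]
    -- Hölder estimate of the bump part
    set S := bumpSum (iteratedDeriv m θ) P s with hS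
    have hSd : ∀ y, HasDerivAt S (bumpSum (iteratedDeriv (m + 1) θ) P s y) y := by
      intro y
      have h1 : ContDiff ℝ ∞ (bumpSum θ P s) := bumpSum_contDiff θ hθ P s
      have h2 : Differentiable ℝ (iteratedDeriv m (bumpSum θ P s)) :=
        h1.differentiable_iteratedDeriv m (by exact_mod_cast WithTop.coe_lt_top _)
      have h3 := (h2 y).hasDerivAt
      rw [← iteratedDeriv_succ, bumpSum_iteratedDeriv θ hθ, bumpSum_iteratedDeriv θ hθ] at h3
      exact h3
    have hLip : ∀ u v, |S u - S v| ≤ B * |u - v| := by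
      intro u v
      have := Convex.norm_image_sub_le_of_norm_hasDerivWithin_le (f := S)
        (f' := bumpSum (iteratedDeriv (m + 1) θ) P s) (s := univ) (x := v) (y := u) (C := B)
        (fun x _ => (hSd x).hasDerivWithinAt) (fun x _ => hSb (m + 1) le_rfl x) convex_univ
        (mem_univ _) (mem_univ _)
      simpa [Real.norm_eq_abs] using this
    have hHol : ∀ u v, |S u - S v| ≤ 2 * B * |u - v| ^ α := by
      intro u v
      rcases le_total |u - v| 1 with h1 | h1
      · have h2 : |u - v| ≤ |u - v| ^ α := by
          calc |u - v| = |u - v| ^ (1:ℝ) := (Real.rpow_one _).symm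
            _ ≤ _ := Real.rpow_le_rpow_of_exponent_ge_of_imp (abs_nonneg _) h1 hα1 (by
              intro _ h; linarith)
        have := hLip u v
        nlinarith [abs_nonneg (u - v)]
      · have h2 : 1 ≤ |u - v| ^ α := Real.one_le_rpow h1 hα0.le
        have h3 : |S u - S v| ≤ 2 * B := by
          have := abs_sub (S u) (S v)
          linarith [hSb m (by omega) u, hSb m (by omega) v]
        nlinarith
    have hpart : |μ * ((2 * (P:ℝ)) ^ m * (S (2 * P * x - P) - S (2 * P * y - P)))| ≤ r ^ α / 2 := by
      have h1 := hHol (2 * P * x - P) (2 * P * y - P)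
      have h2 : |2 * (P:ℝ) * x - P - (2 * P * y - P)| = 2 * P * r := by
        rw [show 2 * (P:ℝ) * x - P - (2 * P * y - P) = 2 * P * (x - y) by ring, abs_mul,
          abs_of_pos (by positivity)]
      rw [h2, Real.mul_rpow (by positivity) hr0, Real.mul_rpow (by norm_num) hP0.le] at h1
      have h3 : (2:ℝ) ^ α ≤ 2 := by
        calc (2:ℝ) ^ α ≤ 2 ^ (1:ℝ) := Real.rpow_le_rpow_of_exponent_le (by norm_num) hα1
          _ = 2 := Real.rpow_one 2
      have h4 : (P:ℝ) ^ (-((m:ℝ) + α)) * (P:ℝ) ^ m * (P:ℝ) ^ α = 1 := by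
        rw [← Real.rpow_natCast, ← Real.rpow_add hP0, ← Real.rpow_add hP0]
        rw [show -((m:ℝ) + α) + m + α = 0 by ring, Real.rpow_zero]
      rw [← mul_assoc, abs_mul, abs_of_nonneg (by positivity)]
      calc μ * (2 * (P:ℝ)) ^ m * |S (2 * P * x - P) - S (2 * P * y - P)|
          ≤ μ * (2 * (P:ℝ)) ^ m * (2 * B * (2 ^ α * (P:ℝ) ^ α * r ^ α)) := by gcongr
        _ = κ * 2 ^ m * (2 * B) * 2 ^ α * r ^ α *
            ((P:ℝ) ^ (-((m:ℝ) + α)) * (P:ℝ) ^ m * (P:ℝ) ^ α) := by rw [hμ, mul_pow]; ring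
        _ = κ * 2 ^ m * (2 * B) * 2 ^ α * r ^ α := by rw [h4, mul_one]
        _ ≤ κ * 2 ^ m * (2 * B) * 2 * r ^ α := by gcongr
        _ = (κ * (2 ^ (m + 2) * B)) * r ^ α := by rw [h2m']; ring
        _ = c / 4 * r ^ α := by rw [hκB]
        _ ≤ _ := by
          have : 0 ≤ r ^ α := by positivity
          nlinarith
    have e : -c * (F * x ^ 1) + μ * ((2 * (P:ℝ)) ^ m * S (2 * P * x - P)) -
        (-c * (F * y ^ 1) + μ * ((2 * (P:ℝ)) ^ m * S (2 * P * y - P))) =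
        -(1 / 4) * (x - y) + μ * ((2 * (P:ℝ)) ^ m * (S (2 * P * x - P) - S (2 * P * y - P))) := by
      rw [← hcF]; ring
    rw [e]
    refine (abs_add_le _ _).trans ?_
    rw [abs_mul, abs_neg, abs_of_pos (by norm_num : (0:ℝ) < 1 / 4), ← hr]
    linarith
  · intro x hx
    have := (hval x hx).1
    linarith
  · apply strictAntiOn_of_deriv_neg (convex_Icc 0 1) hhC.continuous.continuousOn
    rw [interior_Icc]
    intro x hx
    have h1 := hhd 1 le_rfl x
    rw [iteratedDeriv_one] at h1
    rw [h1]
    simp only [Nat.descFactorial_one, Nat.add_sub_cancel]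
    have hxm : 0 < x ^ m := pow_pos hx.1 m
    rcases le_total x (1 / 2) with hx2 | hx2
    · rw [bumpSum_nonpos _ (hsj 1) P s _ (by nlinarith)]
      simp only [mul_zero, add_zero]
      have : 0 < c * (((m + 1 : ℕ):ℝ) * x ^ m) := by positivity
      linarith
    · have h2 : (1 / 2 : ℝ) ^ m ≤ x ^ m := by gcongr
      have hm2 : μ * (2 * (P:ℝ)) ^ 1 ≤ κ * 2 := by
        have h3 : (P:ℝ) ^ (-((m:ℝ) + α)) * (P:ℝ) ^ 1 ≤ 1 := by
          rw [← Real.rpow_natCast, ← Real.rpow_add hP0]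
          apply Real.rpow_le_one_of_one_le_of_nonpos hP1
          have : (1:ℝ) ≤ m := by exact_mod_cast hm
          push_cast
          linarith
        calc μ * (2 * (P:ℝ)) ^ 1 = κ * 2 * ((P:ℝ) ^ (-((m:ℝ) + α)) * (P:ℝ) ^ 1) := by
              rw [hμ]; ring
          _ ≤ κ * 2 * 1 := by gcongr
          _ = _ := mul_one _
      have h4 : μ * ((2 * (P:ℝ)) ^ 1 * bumpSum (iteratedDeriv 1 θ) P s (2 * P * x - P)) ≤
          κ * 2 * B := by
        rw [← mul_assoc]
        calc _ ≤ μ * (2 * (P:ℝ)) ^ 1 * B := by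
              gcongr
              exact (le_abs_self _).trans (hSb 1 (by omega) _)
          _ ≤ _ := mul_le_mul_of_nonneg_right hm2 (by linarith)
      have h5 : κ * 2 * B ≤ c / 8 * (1 / 2) ^ m := by
        have : (2:ℝ) ^ m * (1 / 2) ^ m = 1 := by rw [← mul_pow]; norm_num
        rw [h2m'] at hκB
        have h6 : κ * B = c / 16 * (1 / 2) ^ m := by
          calc κ * B = κ * B * ((2:ℝ) ^ m * (1 / 2) ^ m) := by rw [this, mul_one]
            _ = (κ * (4 * 2 ^ m * B)) / 4 * (1 / 2) ^ m := by ring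
            _ = _ := by rw [hκB]; ring
        linarith
      have h7 : (1:ℝ) ≤ ((m + 1 : ℕ):ℝ) := by exact_mod_cast (by omega : 1 ≤ m + 1)
      have h8 : c * (1 * (1 / 2) ^ m) ≤ c * (((m + 1 : ℕ):ℝ) * x ^ m) := by gcongr
      have h9 : 0 < c * (1 / 2) ^ m := by positivity
      linarith
  · intro j hj hjm
    have h0 : (0:ℝ) ∈ I01 := ⟨le_rfl, by norm_num⟩
    rw [hW j 0 h0, hhd j hj, bumpSum_nonpos _ (hsj j) P s _ (by linarith)]
    rw [zero_pow (by omega)]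
    simp

open scoped ContDiff in
lemma exists_bump : ∃ φ : ℝ → ℝ, ContDiff ℝ ∞ φ ∧ tsupport φ ⊆ Ioo 0 1 ∧ φ (1 / 2) = 1 := by
  let f : ContDiffBump (1 / 2 : ℝ) := ⟨1 / 8, 1 / 4, by norm_num, by norm_num⟩
  refine ⟨f, f.contDiff, ?_, ?_⟩
  · rw [f.tsupport_eq, Real.closedBall_eq_Icc]
    intro x hx
    have h1 : f.rOut = 1 / 4 := rfl
    rw [h1] at hx
    constructor <;> linarith [hx.1, hx.2]
  · exact f.one_of_mem_closedBall (Metric.mem_closedBall_self (by norm_num [f]))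

lemma peak_mem (P : ℕ) (hP : 0 < P) (i : Fin P) :
    (1 / 2 + ((i:ℕ) + 1 / 2) / (2 * P) : ℝ) ∈ Icc (0:ℝ) 1 := by
  have hP0 : (0:ℝ) < P := by exact_mod_cast hP
  have hi : ((i:ℕ):ℝ) + 1 ≤ P := by exact_mod_cast i.2
  have hi0 : (0:ℝ) ≤ (i:ℕ) := by positivity
  constructor
  · positivity
  · have : (((i:ℕ):ℝ) + 1 / 2) / (2 * P) ≤ 1 / 2 := by
      rw [div_le_iff₀ (by positivity)]; linarith
    linarith

lemma peak_arg (P : ℕ) (hP : 0 < P) (i : Fin P) :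
    2 * (P:ℝ) * (1 / 2 + ((i:ℕ) + 1 / 2) / (2 * P)) - P = (i:ℕ) + 1 / 2 := by
  have hP0 : (0:ℝ) < P := by exact_mod_cast hP
  field_simp
  ring

/-- Test functions for the second-order family. -/
lemma testB1 (m : ℕ) (hm : 1 ≤ m) (α : ℝ) (hα0 : 0 < α) (hα1 : α ≤ 1) :
    ∃ κ : ℝ, 0 < κ ∧ κ ≤ 1 ∧ ∀ P : ℕ, 0 < P → ∃ xs g : Fin P → ℝ, (∀ i, xs i ∈ I01) ∧
      (∀ i, |g i| ≤ 1) ∧ ∀ s : Fin P → Bool, ∃ h : ℝ → ℝ, HolderClass1 m α h ∧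
        (∀ x ∈ I01, 0 < h x) ∧ StrictAntiOn h I01 ∧
        (∀ j, 1 ≤ j → j ≤ m → iteratedDerivWithin j h I01 0 = 0) ∧
        (∀ x ∈ I01, |h x| ≤ 1) ∧
        ∀ i, h (xs i) = g i + sgn (s i) * (κ * (P:ℝ) ^ (-((m:ℝ) + α))) := by
  obtain ⟨θ, hθ, hts, h1⟩ := exists_bump
  obtain ⟨c, κ, hc0, hc4, hκ0, hκ1, H⟩ := testFun_props m hm α hα0 hα1 θ hθ hts
  refine ⟨κ, hκ0, hκ1, ?_⟩
  intro P hP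
  refine ⟨fun i => 1 / 2 + ((i:ℕ) + 1 / 2) / (2 * P),
    fun i => c * (2 - (1 / 2 + ((i:ℕ) + 1 / 2) / (2 * P)) ^ (m + 1)), peak_mem P hP, ?_, ?_⟩
  · intro i
    have hx := peak_mem P hP i
    have h2 := pow_le_one₀ (n := m + 1) hx.1 hx.2
    have h3 := pow_nonneg hx.1 (m + 1)
    rw [abs_le]
    constructor <;> nlinarith
  · intro s
    obtain ⟨a1, a2, a3, a4⟩ := H P hP (fun i => sgn (s i)) (fun i => (sgn_abs (s i)).le)
    refine ⟨_, a1, a2, a3, a4, ?_, ?_⟩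
    · intro x hx
      have := a1.2.1 0 (by omega) x hx
      simpa using this
    · intro i
      have hs : ∀ y, y ∉ Ioo (0:ℝ) 1 → θ y = 0 := fun y hy =>
        image_eq_zero_of_notMem_tsupport (fun h => hy (hts h))
      unfold testFun
      rw [peak_arg P hP i, bumpSum_peak θ hs, h1]
      ring

open scoped ContDiff in
/-- Test functions for the first-order family. -/
lemma testB2 (m : ℕ) (hm : 1 ≤ m) (α : ℝ) (hα0 : 0 < α) (hα1 : α ≤ 1) :
    ∃ κ : ℝ, 0 < κ ∧ κ ≤ 1 ∧ ∀ P : ℕ, 0 < P → ∃ xs g : Fin P → ℝ, (∀ i, xs i ∈ I01) ∧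
      (∀ i, |g i| ≤ 1) ∧ ∀ s : Fin P → Bool, ∃ h : ℝ → ℝ, HolderClass1 m α h ∧
        (∀ x ∈ I01, 0 < h x) ∧ StrictAntiOn h I01 ∧
        (∀ j, 1 ≤ j → j ≤ m → iteratedDerivWithin j h I01 0 = 0) ∧
        (∀ x ∈ I01, |∫ t in (0:ℝ)..x, h t| ≤ 1) ∧
        ∀ i, ∫ t in (0:ℝ)..xs i, h t =
          g i + sgn (s i) * (κ * (P:ℝ) ^ (-((m:ℝ) + α + 1))) := by
  obtain ⟨φ, hφ, hts, h1⟩ := exists_bump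
  have hφ' : ContDiff ℝ ∞ (deriv φ) := (contDiff_infty_iff_deriv.1 hφ).2
  obtain ⟨c, κ, hc0, hc4, hκ0, hκ1, H⟩ := testFun_props m hm α hα0 hα1 (deriv φ) hφ'
    (tsupport_deriv_subset.trans hts)
  refine ⟨κ / 2, by linarith, by linarith, ?_⟩
  intro P hP
  have hP0 : (0:ℝ) < P := by exact_mod_cast hP
  have hs0 : ∀ y, y ∉ Ioo (0:ℝ) 1 → φ y = 0 := fun y hy =>
    image_eq_zero_of_notMem_tsupport (fun h => hy (hts h))
  refine ⟨fun i => 1 / 2 + ((i:ℕ) + 1 / 2) / (2 * P),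
    fun i => c * (2 * (1 / 2 + ((i:ℕ) + 1 / 2) / (2 * P)) -
      (1 / 2 + ((i:ℕ) + 1 / 2) / (2 * P)) ^ (m + 2) / (m + 2)), peak_mem P hP, ?_, ?_⟩
  · intro i
    have hx := peak_mem P hP i
    set x : ℝ := 1 / 2 + ((i:ℕ) + 1 / 2) / (2 * P)
    have h2 := pow_le_one₀ (n := m + 2) hx.1 hx.2
    have h3 := pow_nonneg hx.1 (m + 2)
    have h4 : 0 ≤ x ^ (m + 2) / ((m:ℝ) + 2) := by positivity
    have h5 : x ^ (m + 2) / ((m:ℝ) + 2) ≤ 1 := by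
      rw [div_le_one (by positivity)]
      have : (0:ℝ) ≤ m := by positivity
      linarith
    have := hx.1
    have := hx.2
    change |c * (2 * x - x ^ (m + 2) / ((m:ℝ) + 2))| ≤ 1
    rw [abs_le]
    constructor <;> nlinarith
  · intro s
    obtain ⟨a1, a2, a3, a4⟩ := H P hP (fun i => sgn (s i)) (fun i => (sgn_abs (s i)).le)
    set μ : ℝ := κ * (P:ℝ) ^ (-((m:ℝ) + α)) with hμ
    refine ⟨_, a1, a2, a3, a4, ?_, ?_⟩
    · intro x hx
      have := intervalIntegral.norm_integral_le_of_norm_le_const (a := (0:ℝ)) (b := x) (C := 1)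
        (f := testFun m c μ (deriv φ) P (fun i => sgn (s i))) (by
          intro y hy
          rw [uIoc_of_le hx.1] at hy
          have := a1.2.1 0 (by omega) y ⟨hy.1.le, hy.2.trans hx.2⟩
          simpa using this)
      rw [Real.norm_eq_abs, sub_zero, one_mul, abs_of_nonneg hx.1] at this
      exact this.trans hx.2
    · intro i
      have hder : ∀ x : ℝ, HasDerivAt (fun x : ℝ => c * (2 * x - x ^ (m + 2) / (m + 2)) +
          μ / (2 * P) * bumpSum φ P (fun i => sgn (s i)) (2 * P * x - P))
          (testFun m c μ (deriv φ) P (fun i => sgn (s i)) x) x := by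
        intro x
        have hd : ∀ y, HasDerivAt (bumpSum φ P (fun i => sgn (s i)))
            (bumpSum (deriv φ) P (fun i => sgn (s i)) y) y := by
          intro y
          have h2 := (bumpSum_contDiff φ hφ P (fun i => sgn (s i))).differentiable (by simp) y
          have h3 := h2.hasDerivAt
          rw [← iteratedDeriv_one, bumpSum_iteratedDeriv φ hφ, iteratedDeriv_one] at h3
          exact h3
        have hin : HasDerivAt (fun x : ℝ => 2 * (P:ℝ) * x - P) (2 * P) x := by
          simpa using ((hasDerivAt_id x).const_mul (2 * (P:ℝ))).sub_const (P:ℝ)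
        have h4 := ((hd (2 * P * x - P)).comp x hin).const_mul (μ / (2 * P))
        have h5 := (((hasDerivAt_id x).const_mul 2).sub
          ((hasDerivAt_pow (m + 2) x).div_const ((m:ℝ) + 2))).const_mul c
        have h6 := h5.add h4
        unfold testFun
        refine h6.congr_deriv ?_
        have hm2 : ((m:ℝ) + 2) ≠ 0 := by positivity
        have e1 : (m + 2 - 1) = m + 1 := by omega
        rw [e1]
        push_cast
        field_simp
      rw [intervalIntegral.integral_eq_sub_of_hasDerivAt (fun x _ => hder x)
        ((testFun_contDiff m c μ (deriv φ) hφ' P (fun i => sgn (s i))).continuous.intervalIntegrable _ _)]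
      rw [peak_arg P hP i, bumpSum_peak φ hs0, h1, bumpSum_nonpos φ hs0 P _ _ (by linarith)]
      have e2 : (P:ℝ) ^ (-((m:ℝ) + α + 1)) = (P:ℝ) ^ (-((m:ℝ) + α)) / P := by
        rw [show -((m:ℝ) + α + 1) = -((m:ℝ) + α) - 1 by ring, Real.rpow_sub_one hP0.ne']
      rw [e2, hμ, zero_pow (by omega)]
      field_simp
      ring

/-- Polynomially bounded functions. -/
def PolyB (f : ℝ → ℝ) : Prop := ∃ a : ℝ, 0 ≤ a ∧ ∃ c : ℕ, ∀ n : ℝ, 1 ≤ n → f n ≤ a * n ^ c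

lemma PolyB.add {f g : ℝ → ℝ} (hf : PolyB f) (hg : PolyB g) : PolyB (fun n => f n + g n) := by
  obtain ⟨a, ha, c, h1⟩ := hf
  obtain ⟨a', ha', c', h2⟩ := hg
  refine ⟨a + a', by positivity, max c c', ?_⟩
  intro n hn
  have e1 : n ^ c ≤ n ^ max c c' := pow_le_pow_right₀ hn (le_max_left _ _)
  have e2 : n ^ c' ≤ n ^ max c c' := pow_le_pow_right₀ hn (le_max_right _ _)
  have := h1 n hn
  have := h2 n hn
  nlinarith

lemma PolyB.rpow (C p : ℝ) (hC : 0 ≤ C) : PolyB (fun n => C * n ^ p) := by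
  refine ⟨C, hC, ⌈p⌉₊, ?_⟩
  intro n hn
  have : n ^ p ≤ n ^ (⌈p⌉₊ : ℕ) := by
    rw [← Real.rpow_natCast]
    exact Real.rpow_le_rpow_of_exponent_le hn (Nat.le_ceil p)
  exact mul_le_mul_of_nonneg_left this hC

lemma PolyB.const (C : ℝ) (hC : 0 ≤ C) : PolyB (fun _ => C) := by
  refine ⟨C, hC, 0, ?_⟩
  intro n hn
  simp

lemma PolyB.npow (a : ℝ) (ha : 0 ≤ a) (c : ℕ) : PolyB (fun n => a * n ^ c) :=
  ⟨a, ha, c, fun _ _ => le_rfl⟩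

/-- Growth bound on the polydisc. -/
lemma growth_bound (A u v b t d X Y p₁ p₂ : ℝ) (hA : 0 ≤ A) (hu : 0 ≤ u) (hb : 0 ≤ b) (hd : 0 ≤ d)
    (hX : 0 ≤ X) (hY : 0 ≤ Y) :
    ∃ a : ℝ, 0 ≤ a ∧ ∃ c : ℕ, ∀ n : ℝ, 1 ≤ n → ∀ S T : ℝ, 0 ≤ S → S ≤ X * n ^ p₁ → 0 ≤ T →
      T ≤ Y * n ^ p₂ →
      A * Real.exp (u * n ^ v) * Real.exp (b * n ^ t * (S ^ d + T ^ d)) ≤ Real.exp (a * n ^ c) := by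
  obtain ⟨a, ha, c, h⟩ := (((PolyB.const A hA).add (PolyB.rpow u v hu)).add
    (PolyB.rpow (b * X ^ d) (t + p₁ * d) (by positivity))).add
    (PolyB.rpow (b * Y ^ d) (t + p₂ * d) (by positivity))
  refine ⟨a, ha, c, ?_⟩
  intro n hn S T hS hSX hT hTY
  have hn0 : 0 < n := by linarith
  have hA' : A ≤ Real.exp A := by linarith [Real.add_one_le_exp A]
  have h1 : S ^ d ≤ X ^ d * n ^ (p₁ * d) := by
    rw [Real.rpow_mul hn0.le, ← Real.mul_rpow hX (by positivity)]
    exact Real.rpow_le_rpow hS hSX hd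
  have h2 : T ^ d ≤ Y ^ d * n ^ (p₂ * d) := by
    rw [Real.rpow_mul hn0.le, ← Real.mul_rpow hY (by positivity)]
    exact Real.rpow_le_rpow hT hTY hd
  calc A * Real.exp (u * n ^ v) * Real.exp (b * n ^ t * (S ^ d + T ^ d))
      ≤ Real.exp A * Real.exp (u * n ^ v) *
        Real.exp (b * n ^ t * (X ^ d * n ^ (p₁ * d) + Y ^ d * n ^ (p₂ * d))) := by gcongr
    _ = Real.exp (A + u * n ^ v + b * X ^ d * n ^ (t + p₁ * d) + b * Y ^ d * n ^ (t + p₂ * d)) := by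
        rw [← Real.exp_add, ← Real.exp_add, Real.rpow_add hn0, Real.rpow_add hn0]
        congr 1; ring
    _ ≤ _ := Real.exp_le_exp.2 (h n hn)

/-- Separate differentiability of a good family in the joint variables. -/
lemma GoodFamily.diff {N M : ℕ} {A u v b t d : ℝ} {g : ℝ → (Fin N → ℂ) → (Fin M → ℂ) → ℂ}
    (hg : GoodFamily N M A u v b t d g) (D : Fin N ⊕ Fin M → Set ℂ)
    (hD : ∀ i, ∀ w ∈ D (Sum.inr i), 0 < w.re) (x : ℝ) (hx : x ∈ I01)
    (z : Fin N ⊕ Fin M → ℂ) (hz : ∀ j, z j ∈ D j) (j : Fin N ⊕ Fin M) :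
    DifferentiableOn ℂ (fun s => g x (Function.update z j s ∘ Sum.inl)
      (Function.update z j s ∘ Sum.inr)) (D j) := by
  obtain ⟨-, h2, h3, -⟩ := hg
  have hw : z ∘ Sum.inr ∈ Wset M := fun i => hD i _ (hz _)
  rcases j with j | i
  · simp only [Sum.update_inl_comp_inl, Sum.update_inl_comp_inr]
    intro s hs
    have e1 : DifferentiableAt ℂ (fun ζ => g x ζ (z ∘ Sum.inr)) (Function.update (z ∘ Sum.inl) j s) :=
      (h2 x hx _ hw _ (mem_univ _)).differentiableAt
    exact (e1.comp s (hasFDerivAt_update (z ∘ Sum.inl) s).differentiableAt).differentiableWithinAt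
  · simp only [Sum.update_inr_comp_inl, Sum.update_inr_comp_inr]
    intro s hs
    have hw' : Function.update (z ∘ Sum.inr) i s ∈ Wset M := by
      intro k
      by_cases hk : k = i
      · subst hk; rw [Function.update_self]; exact hD k s hs
      · rw [Function.update_of_ne hk]; exact hw k
    have e1 : DifferentiableAt ℂ (fun w => g x (z ∘ Sum.inl) w) (Function.update (z ∘ Sum.inr) i s) :=
      (h3 x hx _ _ hw').differentiableAt
    exact (e1.comp s (hasFDerivAt_update (z ∘ Sum.inr) s).differentiableAt).differentiableWithinAt

/-- Elementary estimate for the second-order numerator. -/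
lemma num2_bound (β p E Ek : ℝ) (k ψ ψ' ψ'' : ℂ) (hβ : 0 < β) (hE : 0 ≤ E) (hEk : 0 ≤ Ek)
    (h1 : 1 / β ≤ Real.exp p) (hk : ‖k‖ ≤ Real.exp Ek) (h2 : ‖ψ‖ ≤ Real.exp E)
    (h3 : ‖ψ'‖ ≤ Real.exp E) (h4 : ‖ψ''‖ ≤ Real.exp E) :
    ‖((1 / β : ℝ) : ℂ) * (k * ψ ^ 2 + ψ'' * ψ - ψ' ^ 2)‖ ≤ Real.exp (p + 2 + Ek + 2 * E) := by
  have e3 : (3:ℝ) ≤ Real.exp 2 := by linarith [Real.add_one_le_exp (2:ℝ)]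
  have hE1 : 1 ≤ Real.exp Ek := Real.one_le_exp hEk
  have hEE : Real.exp (2 * E) = Real.exp E * Real.exp E := by rw [two_mul, Real.exp_add]
  have a1 : ‖k * ψ ^ 2‖ ≤ Real.exp Ek * (Real.exp E * Real.exp E) := by
    rw [norm_mul, norm_pow, sq]; gcongr
  have a2 : ‖ψ'' * ψ‖ ≤ Real.exp Ek * (Real.exp E * Real.exp E) := by
    rw [norm_mul]
    calc _ ≤ 1 * (Real.exp E * Real.exp E) := by rw [one_mul]; gcongr
      _ ≤ _ := by gcongr
  have a3 : ‖ψ' ^ 2‖ ≤ Real.exp Ek * (Real.exp E * Real.exp E) := by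
    rw [norm_pow, sq]
    calc _ ≤ 1 * (Real.exp E * Real.exp E) := by rw [one_mul]; gcongr
      _ ≤ _ := by gcongr
  have a4 : ‖k * ψ ^ 2 + ψ'' * ψ - ψ' ^ 2‖ ≤ 3 * (Real.exp Ek * (Real.exp E * Real.exp E)) := by
    refine (norm_sub_le _ _).trans ?_
    have := norm_add_le (k * ψ ^ 2) (ψ'' * ψ)
    linarith
  rw [norm_mul, Complex.norm_real, Real.norm_of_nonneg (by positivity)]
  calc _ ≤ Real.exp p * (3 * (Real.exp Ek * (Real.exp E * Real.exp E))) := by gcongr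
    _ ≤ Real.exp p * (Real.exp 2 * (Real.exp Ek * (Real.exp E * Real.exp E))) := by gcongr
    _ = _ := by rw [Real.exp_add, Real.exp_add, Real.exp_add, hEE]; ring

set_option maxHeartbeats 2000000 in
/-- Lower bound for the second-order family. -/
lemma second_order (m : ℕ) (hm : 1 ≤ m) (α : ℝ) (hα0 : 0 < α) (hα1 : α ≤ 1)
    (A u v b t d : ℝ) (hA : 1 ≤ A) (hu : 1 ≤ u) (hb : 1 ≤ b) (hd : 1 ≤ d)
    (Ak uk vk bk tk dk : ℝ) (hAk : 1 ≤ Ak) (huk : 1 ≤ uk)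
    (hbk : 1 ≤ bk) (hdk : 1 ≤ dk)
    (B₁ B₂ r₁ r₂ : ℝ) (hB₁ : 1 ≤ B₁) (hB₂ : 1 ≤ B₂)
    (ε : ℝ) (hε0 : 0 < ε) (hε1 : ε < 1)
    (C₀ α₀ β₀ : ℝ) (hC₀ : 0 < C₀) (hα₀ : 0 < α₀)
    (Ck pk Cb pb : ℝ) (hCk : 0 < Ck) (hCb : 0 < Cb) :
    ∃ C' : ℝ, 0 < C' ∧
      ∀ N M : ℕ, 2 ≤ N →
      ∀ ψ ψx ψxx kf : ℝ → (Fin N → ℂ) → (Fin M → ℂ) → ℂ, ∀ β₁ : ℝ,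
      ∀ a : Fin M → ℝ,
      (∀ (ζ : Fin N → ℂ) (w : Fin M → ℂ), ∀ x ∈ I01,
        HasDerivWithinAt (fun x' => ψ x' ζ w) (ψx x ζ w) I01 x) →
      (∀ (ζ : Fin N → ℂ) (w : Fin M → ℂ), ∀ x ∈ I01,
        HasDerivWithinAt (fun x' => ψx x' ζ w) (ψxx x ζ w) I01 x) →
      GoodFamily N M A u v b t d ψ →
      GoodFamily N M A u v b t d ψx →
      GoodFamily N M A u v b t d ψxx →
      GoodFamily N M Ak uk vk bk tk dk kf →
      (∀ i, 0 < a i ∧ a i ≤ B₂ * ((M:ℝ) + N) ^ r₂) →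
      (∀ (ζ : Fin N → ℝ) (w : Fin M → ℝ), InOmega N M B₁ r₁ ε a ζ w → ∀ x ∈ I01,
        ‖kf x (fun j => (ζ j : ℂ)) (fun i => (w i : ℂ))‖ ≤ Ck * ((N:ℝ) + M) ^ pk) →
      (∀ (ζ : Fin N → ℝ) (w : Fin M → ℝ), InOmega N M B₁ r₁ ε a ζ w →
        ‖(ψ 0 (fun j => (ζ j : ℂ)) (fun i => (w i : ℂ)))⁻¹‖
            ≤ C₀ * Real.exp (α₀ * ((M:ℝ) + N) ^ β₀) ∧
          ψx 0 (fun j => (ζ j : ℂ)) (fun i => (w i : ℂ)) = 0) →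
      (0 < β₁ ∧ β₁ ≤ Cb * ((N:ℝ) + M) ^ pb ∧ 1 / β₁ ≤ Cb * ((N:ℝ) + M) ^ pb) →
      (∃ h : ℝ → ℝ, HolderClass1 m α h ∧
        (∀ x ∈ I01, 0 < h x) ∧ StrictAntiOn h I01 ∧
        (∀ j, 1 ≤ j → j ≤ m → iteratedDerivWithin j h I01 0 = 0) ∧
        ∀ (ζ : Fin N → ℝ) (w : Fin M → ℝ), InOmega N M B₁ r₁ ε a ζ w →
          ∃ x ∈ I01,
            C' / (((N:ℝ) + M) ^ ((m:ℝ) + α) * (Real.log ((N:ℝ) + M)) ^ ((m:ℝ) + α)) ≤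
              ‖(h x : ℂ) - ((1 / β₁ : ℝ) : ℂ) *
                (kf x (fun j => (ζ j : ℂ)) (fun i => (w i : ℂ)) +
                  (ψxx x (fun j => (ζ j : ℂ)) (fun i => (w i : ℂ)) *
                      ψ x (fun j => (ζ j : ℂ)) (fun i => (w i : ℂ)) -
                    (ψx x (fun j => (ζ j : ℂ)) (fun i => (w i : ℂ))) ^ 2) /
                  (ψ x (fun j => (ζ j : ℂ)) (fun i => (w i : ℂ))) ^ 2)‖) := by
  obtain ⟨κ, hκ0, hκ1, hT⟩ := testB1 m hm α hα0 hα1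
  set q : ℝ := (1 - ε) / (1 - ε / 2) with hq
  have hq0 : 0 < q := div_pos (by linarith) (by linarith)
  have hq1 : q < 1 := by rw [hq, div_lt_one (by linarith)]; linarith
  obtain ⟨a₁, ha₁, c₁, hg₁⟩ := growth_bound A u v b t d (B₁ / q) (2 * B₂) (r₁ + 1) (r₂ + 1)
    (by linarith) (by linarith) (by linarith) (by linarith) (by positivity) (by linarith)
  obtain ⟨a₂, ha₂, c₂, hg₂⟩ := growth_bound Ak uk vk bk tk dk (B₁ / q) (2 * B₂) (r₁ + 1) (r₂ + 1)
    (by linarith) (by linarith) (by linarith) (by linarith) (by positivity) (by linarith)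
  obtain ⟨aa, haa, cc, hpoly⟩ := (((((PolyB.rpow (5 * Cb) pb (by linarith)).add
    (PolyB.const (2 + 2 * C₀) (by linarith))).add (PolyB.npow a₂ ha₂ c₂)).add
    (PolyB.npow (2 * a₁) (by linarith) c₁)).add (PolyB.rpow (2 * Ck) pk (by linarith))).add
    (PolyB.rpow (2 * α₀) β₀ (by linarith))
  have hm0 : (0:ℝ) < m := by exact_mod_cast hm
  obtain ⟨C', hC', hmid⟩ := middle ((m:ℝ) + α) κ q aa (by linarith) hκ0 hκ1 hq0 hq1 haa cc
  refine ⟨C', hC', ?_⟩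
  intro N M hN ψ ψx ψxx kf β a hψ hψx gψ gψx gψxx gk ha hk hinv ⟨hβ0, hβ1, hβ2⟩
  obtain ⟨P, hP, hthr, hmid⟩ := hmid (N + M) (by omega)
  obtain ⟨xs, g, hxs, hg, hT⟩ := hT P hP
  have hcast : ((N + M : ℕ) : ℝ) = (N:ℝ) + M := by push_cast; ring
  have hcomm : (M:ℝ) + N = (N:ℝ) + M := add_comm _ _
  rw [hcast] at hthr hmid
  simp only [InOmega, hcomm] at ha hk hinv ⊢
  set n : ℝ := (N:ℝ) + M with hn
  have hN2 : (2:ℝ) ≤ N := by exact_mod_cast hN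
  have hM0 : (0:ℝ) ≤ M := by positivity
  have hn1 : 1 ≤ n := by linarith
  have hn0 : 0 < n := by linarith
  have hpol := hpoly n hn1
  set X : ℝ := aa * n ^ cc with hX
  -- nonnegativity of all summands
  have p1 : 0 ≤ Cb * n ^ pb := by positivity
  have p3 : 0 ≤ a₂ * n ^ c₂ := by positivity
  have p4 : 0 ≤ a₁ * n ^ c₁ := by positivity
  have p5 : 0 ≤ Ck * n ^ pk := by positivity
  have p6 : 0 ≤ α₀ * n ^ β₀ := by positivity
  have hpol' : 5 * (Cb * n ^ pb) + (2 + 2 * C₀) + a₂ * n ^ c₂ + 2 * (a₁ * n ^ c₁) +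
      2 * (Ck * n ^ pk) + 2 * (α₀ * n ^ β₀) ≤ X := by
    refine le_trans (le_of_eq ?_) hpol
    ring
  -- polydisc
  set cen : Fin N ⊕ Fin M → ℂ := Sum.elim (fun _ => 0) (fun i => (a i : ℂ)) with hcen
  set ρ : Fin N ⊕ Fin M → ℝ := Sum.elim (fun _ => B₁ * n ^ r₁) (fun i => (1 - ε) * a i) with hρ
  have hρ0 : ∀ j, 0 < ρ j := by
    rintro (j | i)
    · simp only [hρ, Sum.elim_inl]; positivity
    · simp only [hρ, Sum.elim_inr]; exact mul_pos (by linarith) (ha i).1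
  have hρq : ∀ i, ρ (Sum.inr i) / q = (1 - ε / 2) * a i := by
    intro i
    have e1 : (1 - ε) ≠ 0 := by linarith
    have e2 : (1 - ε / 2) ≠ 0 := by linarith
    simp only [hρ, Sum.elim_inr, hq]
    field_simp
  have hwpos : ∀ i, ∀ w ∈ Metric.closedBall (cen (Sum.inr i)) (ρ (Sum.inr i) / q), 0 < w.re := by
    intro i w hw
    rw [hρq, mem_closedBall_iff_norm] at hw
    have e1 := (Complex.abs_re_le_norm (w - cen (Sum.inr i))).trans hw
    simp only [hcen, Sum.elim_inr, Complex.sub_re, Complex.ofReal_re] at e1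
    have e2 := (abs_le.1 e1).1
    have := (ha i).1
    nlinarith
  have hsum1 : ∀ z : Fin N ⊕ Fin M → ℂ, (∀ j, z j ∈ Metric.closedBall (cen j) (ρ j / q)) →
      ∑ j, ‖(z ∘ Sum.inl) j‖ ≤ B₁ / q * n ^ (r₁ + 1) := by
    intro z hz
    have e1 : ∀ j : Fin N, ‖(z ∘ Sum.inl) j‖ ≤ B₁ / q * n ^ r₁ := by
      intro j
      have := hz (Sum.inl j)
      rw [mem_closedBall_iff_norm] at this
      simp only [hcen, hρ, Sum.elim_inl, sub_zero] at this
      refine this.trans (le_of_eq (by ring))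
    calc ∑ j, ‖(z ∘ Sum.inl) j‖ ≤ ∑ _j : Fin N, B₁ / q * n ^ r₁ := Finset.sum_le_sum fun j _ => e1 j
      _ = N * (B₁ / q * n ^ r₁) := by simp
      _ ≤ n * (B₁ / q * n ^ r₁) := by gcongr; linarith
      _ = _ := by rw [Real.rpow_add_one hn0.ne']; ring
  have hsum2 : ∀ z : Fin N ⊕ Fin M → ℂ, (∀ j, z j ∈ Metric.closedBall (cen j) (ρ j / q)) →
      ∑ j, ‖(z ∘ Sum.inr) j‖ ≤ 2 * B₂ * n ^ (r₂ + 1) := by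
    intro z hz
    have e1 : ∀ j : Fin M, ‖(z ∘ Sum.inr) j‖ ≤ 2 * (B₂ * n ^ r₂) := by
      intro j
      have := hz (Sum.inr j)
      rw [hρq, mem_closedBall_iff_norm] at this
      have e2 := norm_add_le (z (Sum.inr j) - cen (Sum.inr j)) (cen (Sum.inr j))
      rw [sub_add_cancel] at e2
      have e3 : ‖cen (Sum.inr j)‖ = a j := by
        simp only [hcen, Sum.elim_inr, Complex.norm_real, Real.norm_eq_abs, abs_of_pos (ha j).1]
      have := (ha j).1
      have := (ha j).2
      simp only [Function.comp_apply]
      nlinarith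
    calc ∑ j, ‖(z ∘ Sum.inr) j‖ ≤ ∑ _j : Fin M, 2 * (B₂ * n ^ r₂) :=
          Finset.sum_le_sum fun j _ => e1 j
      _ = M * (2 * (B₂ * n ^ r₂)) := by simp
      _ ≤ n * (2 * (B₂ * n ^ r₂)) := by gcongr; linarith
      _ = _ := by rw [Real.rpow_add_one hn0.ne']; ring
  have hW : ∀ z : Fin N ⊕ Fin M → ℂ, (∀ j, z j ∈ Metric.closedBall (cen j) (ρ j / q)) →
      z ∘ Sum.inr ∈ Wset M := fun z hz i => hwpos i _ (hz _)
  have hbd : ∀ G : ℝ → (Fin N → ℂ) → (Fin M → ℂ) → ℂ, GoodFamily N M A u v b t d G →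
      ∀ x ∈ I01, ∀ z : Fin N ⊕ Fin M → ℂ, (∀ j, z j ∈ Metric.closedBall (cen j) (ρ j / q)) →
      ‖G x (z ∘ Sum.inl) (z ∘ Sum.inr)‖ ≤ Real.exp (a₁ * n ^ c₁) := by
    intro G hG x hx z hz
    exact (hG.2.2.2 _ _ (hW z hz) x hx).trans (hg₁ n hn1 _ _
      (Finset.sum_nonneg fun _ _ => norm_nonneg _) (hsum1 z hz)
      (Finset.sum_nonneg fun _ _ => norm_nonneg _) (hsum2 z hz))
  have hbdk : ∀ x ∈ I01, ∀ z : Fin N ⊕ Fin M → ℂ,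
      (∀ j, z j ∈ Metric.closedBall (cen j) (ρ j / q)) →
      ‖kf x (z ∘ Sum.inl) (z ∘ Sum.inr)‖ ≤ Real.exp (a₂ * n ^ c₂) := by
    intro x hx z hz
    exact (gk.2.2.2 _ _ (hW z hz) x hx).trans (hg₂ n hn1 _ _
      (Finset.sum_nonneg fun _ _ => norm_nonneg _) (hsum1 z hz)
      (Finset.sum_nonneg fun _ _ => norm_nonneg _) (hsum2 z hz))
  have hβe : 1 / β ≤ Real.exp (Cb * n ^ pb) :=
    hβ2.trans (by linarith [Real.add_one_le_exp (Cb * n ^ pb)])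
  -- the two families
  let Num : Bool → Fin P → (Fin N ⊕ Fin M → ℂ) → ℂ := fun f i z =>
    if f then ((1 / β : ℝ) : ℂ) * (kf (xs i) (z ∘ Sum.inl) (z ∘ Sum.inr) *
        ψ (xs i) (z ∘ Sum.inl) (z ∘ Sum.inr) ^ 2 +
        ψxx (xs i) (z ∘ Sum.inl) (z ∘ Sum.inr) * ψ (xs i) (z ∘ Sum.inl) (z ∘ Sum.inr) -
        ψx (xs i) (z ∘ Sum.inl) (z ∘ Sum.inr) ^ 2)
    else ((1 / β : ℝ) : ℂ) * kf (xs i) (z ∘ Sum.inl) (z ∘ Sum.inr)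
  let Den : Bool → Fin P → (Fin N ⊕ Fin M → ℂ) → ℂ := fun f i z =>
    if f then ψ (xs i) (z ∘ Sum.inl) (z ∘ Sum.inr) ^ 2 else 1
  obtain ⟨s, hs⟩ := hmid (Fin N ⊕ Fin M) (by simp) cen ρ hρ0 Num Den
    (by
      intro f i z hz j
      have d1 := gψ.diff (fun j => Metric.closedBall (cen j) (ρ j / q)) hwpos (xs i) (hxs i) z hz j
      have d2 := gψx.diff (fun j => Metric.closedBall (cen j) (ρ j / q)) hwpos (xs i) (hxs i) z hz j
      have d3 := gψxx.diff (fun j => Metric.closedBall (cen j) (ρ j / q)) hwpos (xs i) (hxs i) z hz j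
      have d4 := gk.diff (fun j => Metric.closedBall (cen j) (ρ j / q)) hwpos (xs i) (hxs i) z hz j
      cases f
      · exact d4.const_mul _
      · exact (((d4.mul (d1.pow 2)).add (d3.mul d1)).sub (d2.pow 2)).const_mul _)
    (by
      intro f i z hz j
      have d1 := gψ.diff (fun j => Metric.closedBall (cen j) (ρ j / q)) hwpos (xs i) (hxs i) z hz j
      cases f
      · exact differentiableOn_const _
      · exact d1.pow 2)
    (by
      intro f i z hz
      have b1 := hbd ψ gψ (xs i) (hxs i) z hz
      have b2 := hbd ψx gψx (xs i) (hxs i) z hz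
      have b3 := hbd ψxx gψxx (xs i) (hxs i) z hz
      have b4 := hbdk (xs i) (hxs i) z hz
      cases f
      · constructor
        · change ‖((1 / β : ℝ) : ℂ) * kf (xs i) (z ∘ Sum.inl) (z ∘ Sum.inr)‖ ≤ _
          rw [norm_mul, Complex.norm_real, Real.norm_of_nonneg (by positivity)]
          calc _ ≤ Real.exp (Cb * n ^ pb) * Real.exp (a₂ * n ^ c₂) := by gcongr
            _ = Real.exp (Cb * n ^ pb + a₂ * n ^ c₂) := (Real.exp_add _ _).symm
            _ ≤ _ := Real.exp_le_exp.2 (by linarith)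
        · change ‖(1:ℂ)‖ ≤ _
          rw [norm_one]
          exact Real.one_le_exp (by linarith)
      · constructor
        · refine (num2_bound β (Cb * n ^ pb) (a₁ * n ^ c₁) (a₂ * n ^ c₂) _ _ _ _ hβ0 p4 p3 hβe
            b4 b1 b2 b3).trans (Real.exp_le_exp.2 (by linarith))
        · change ‖ψ (xs i) (z ∘ Sum.inl) (z ∘ Sum.inr) ^ 2‖ ≤ _
          rw [norm_pow, sq]
          calc _ ≤ Real.exp (a₁ * n ^ c₁) * Real.exp (a₁ * n ^ c₁) := by gcongr
            _ = Real.exp (a₁ * n ^ c₁ + a₁ * n ^ c₁) := (Real.exp_add _ _).symm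
            _ ≤ _ := Real.exp_le_exp.2 (by linarith))
    g hg
  obtain ⟨h, h1, h2, h3, h4, h5, h6⟩ := hT s
  refine ⟨h, h1, h2, h3, h4, ?_⟩
  intro ζ w hΩ
  by_contra hcon
  push Not at hcon
  have hPL : κ * (P:ℝ) ^ (-((m:ℝ) + α)) / 10 ≤ 1 := by
    have : (P:ℝ) ^ (-((m:ℝ) + α)) ≤ 1 :=
      Real.rpow_le_one_of_one_le_of_nonpos (by exact_mod_cast hP) (by linarith)
    have : 0 ≤ (P:ℝ) ^ (-((m:ℝ) + α)) := by positivity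
    nlinarith
  set ζc : Fin N → ℂ := fun j => (ζ j : ℂ) with hζc
  set wc : Fin M → ℂ := fun i => (w i : ℂ) with hwc
  have hkb := hk ζ w hΩ
  obtain ⟨hi1, hi2⟩ := hinv ζ w hΩ
  -- bound on the logarithmic second derivative
  have hQ : ∀ x ∈ Icc (0:ℝ) 1, ‖(ψxx x ζc wc * ψ x ζc wc - ψx x ζc wc ^ 2) / ψ x ζc wc ^ 2‖ ≤
      2 * β + Ck * n ^ pk := by
    intro x hx
    have e1 := hcon x hx
    set Q := (ψxx x ζc wc * ψ x ζc wc - ψx x ζc wc ^ 2) / ψ x ζc wc ^ 2 with hQdef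
    have e2 : ‖((1 / β : ℝ) : ℂ) * (kf x ζc wc + Q)‖ ≤ 2 := by
      have e3 := norm_sub_le (h x : ℂ) ((h x : ℂ) - ((1 / β : ℝ) : ℂ) * (kf x ζc wc + Q))
      rw [sub_sub_cancel] at e3
      have e4 : ‖(h x : ℂ)‖ ≤ 1 := by
        rw [Complex.norm_real, Real.norm_eq_abs]; exact h5 x hx
      linarith
    rw [norm_mul, Complex.norm_real, Real.norm_of_nonneg (by positivity), one_div,
      inv_mul_le_iff₀ hβ0] at e2
    have e5 := norm_sub_le (kf x ζc wc + Q) (kf x ζc wc)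
    rw [add_sub_cancel_left] at e5
    have := hkb x hx
    linarith
  have hK0 : 0 ≤ 2 * β + Ck * n ^ pk := by positivity
  obtain ⟨D1, D2⟩ := dich2 (fun x => ψ x ζc wc) (fun x => ψx x ζc wc) (fun x => ψxx x ζc wc)
    (fun x hx => hψ ζc wc x hx) (fun x hx => hψx ζc wc x hx) hi2 _ hK0 hQ
  let z : Fin N ⊕ Fin M → ℂ := Sum.elim ζc wc
  have hz : ∀ j, z j ∈ Metric.closedBall (cen j) (ρ j) := by
    rintro (j | i)
    · rw [mem_closedBall_iff_norm]
      simp only [z, hcen, hρ, Sum.elim_inl, sub_zero, hζc, Complex.norm_real, Real.norm_eq_abs]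
      exact hΩ.1 j
    · rw [mem_closedBall_iff_norm]
      simp only [z, hcen, hρ, Sum.elim_inr, hwc]
      rw [← Complex.ofReal_sub, Complex.norm_real, Real.norm_eq_abs]
      exact (hΩ.2 i).2
  by_cases h0 : ψ 0 ζc wc = 0
  · have hv := D2 h0
    obtain ⟨i, hi⟩ := hs false z hz (by
      intro i
      change _ ≤ ‖(1:ℂ)‖
      rw [norm_one, Real.exp_le_one_iff]
      linarith)
    have e1 := (hcon (xs i) (hxs i)).trans_le hthr
    have e2 : ψ (xs i) ζc wc = 0 := hv (xs i) (hxs i)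
    rw [← h6 i] at hi
    have e3 : Num false i z / Den false i z = ((1 / β : ℝ) : ℂ) * kf (xs i) ζc wc := by
      change ((1 / β : ℝ) : ℂ) * kf (xs i) ζc wc / 1 = _
      rw [div_one]
    rw [e3] at hi
    rw [e2] at e1
    simp only [ne_eq, OfNat.ofNat_ne_zero, not_false_eq_true, zero_pow, div_zero, add_zero] at e1
    exact lt_asymm hi e1
  · have hv := D1 h0
    have hlow : ∀ x ∈ I01, Real.exp (-(C₀ + α₀ * n ^ β₀ + (2 * β + Ck * n ^ pk))) ≤
        ‖ψ x ζc wc‖ := by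
      intro x hx
      have e1 := hv x hx
      have e0 : 0 < ‖ψ 0 ζc wc‖ := norm_pos_iff.2 h0
      have e2 : 1 ≤ Real.exp (C₀ + α₀ * n ^ β₀) * ‖ψ 0 ζc wc‖ := by
        rw [norm_inv, inv_le_iff_one_le_mul₀ e0] at hi1
        refine hi1.trans ?_
        rw [Real.exp_add]
        gcongr
        linarith [Real.add_one_le_exp C₀]
      rw [Real.exp_neg, inv_le_iff_one_le_mul₀ (Real.exp_pos _), Real.exp_add]
      calc 1 ≤ Real.exp (C₀ + α₀ * n ^ β₀) * ‖ψ 0 ζc wc‖ := e2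
        _ ≤ Real.exp (C₀ + α₀ * n ^ β₀) * (Real.exp (2 * β + Ck * n ^ pk) * ‖ψ x ζc wc‖) := by
          gcongr
        _ = _ := by ring
    obtain ⟨i, hi⟩ := hs true z hz (by
      intro i
      change _ ≤ ‖ψ (xs i) ζc wc ^ 2‖
      rw [norm_pow, sq]
      calc Real.exp (-X) ≤ Real.exp (-(C₀ + α₀ * n ^ β₀ + (2 * β + Ck * n ^ pk)) +
            -(C₀ + α₀ * n ^ β₀ + (2 * β + Ck * n ^ pk))) := Real.exp_le_exp.2 (by linarith)
        _ = _ := Real.exp_add _ _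
        _ ≤ _ := by gcongr <;> exact hlow _ (hxs i))
    have e1 := (hcon (xs i) (hxs i)).trans_le hthr
    have hne : ψ (xs i) ζc wc ≠ 0 := by
      intro e
      have := hlow (xs i) (hxs i)
      rw [e, norm_zero] at this
      exact absurd this (not_le.2 (Real.exp_pos _))
    rw [← h6 i] at hi
    have e3 : Num true i z / Den true i z = ((1 / β : ℝ) : ℂ) * (kf (xs i) ζc wc +
        (ψxx (xs i) ζc wc * ψ (xs i) ζc wc - ψx (xs i) ζc wc ^ 2) / ψ (xs i) ζc wc ^ 2) := by
      change ((1 / β : ℝ) : ℂ) * (kf (xs i) ζc wc * ψ (xs i) ζc wc ^ 2 +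
        ψxx (xs i) ζc wc * ψ (xs i) ζc wc - ψx (xs i) ζc wc ^ 2) / ψ (xs i) ζc wc ^ 2 = _
      rw [mul_div_assoc, add_sub_assoc, add_div, mul_div_cancel_right₀ _ (pow_ne_zero 2 hne)]
    rw [e3] at hi
    exact lt_asymm hi e1

set_option maxHeartbeats 2000000 in
/-- Lower bound for the first-order family. -/
lemma first_order (m : ℕ) (hm : 1 ≤ m) (α : ℝ) (hα0 : 0 < α) (hα1 : α ≤ 1)
    (A u v b t d : ℝ) (hA : 1 ≤ A) (hu : 1 ≤ u) (hb : 1 ≤ b) (hd : 1 ≤ d)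
    (B₁ r₁ : ℝ) (hB₁ : 1 ≤ B₁)
    (C₀ α₀ β₀ : ℝ) (hC₀ : 0 < C₀) (hα₀ : 0 < α₀)
    (Cb pb : ℝ) (hCb : 0 < Cb) :
    ∃ C' : ℝ, 0 < C' ∧
      ∀ N : ℕ, 2 ≤ N →
      ∀ ψ₂ ψ₂x : ℝ → (Fin N → ℂ) → ℂ, ∀ β₂ : ℝ,
      (∀ ζ : Fin N → ℂ, ∀ x ∈ I01,
        HasDerivWithinAt (fun x' => ψ₂ x' ζ) (ψ₂x x ζ) I01 x) →
      (∀ x ∈ I01, AnalyticOnNhd ℂ (fun ζ => ψ₂ x ζ) univ) →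
      (∀ x ∈ I01, AnalyticOnNhd ℂ (fun ζ => ψ₂x x ζ) univ) →
      (∀ ζ : Fin N → ℂ, ∀ x ∈ I01,
        ‖ψ₂ x ζ‖ ≤ A * Real.exp (u * (N:ℝ) ^ v) *
          Real.exp (b * (N:ℝ) ^ t * (∑ j, ‖ζ j‖) ^ d)) →
      (∀ ζ : Fin N → ℂ, ∀ x ∈ I01,
        ‖ψ₂x x ζ‖ ≤ A * Real.exp (u * (N:ℝ) ^ v) *
          Real.exp (b * (N:ℝ) ^ t * (∑ j, ‖ζ j‖) ^ d)) →
      (∀ ζ : Fin N → ℝ, (∀ j, |ζ j| ≤ B₁ * (N:ℝ) ^ r₁) →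
        ‖(ψ₂ 0 (fun j => (ζ j : ℂ)))⁻¹‖ ≤ C₀ * Real.exp (α₀ * (N:ℝ) ^ β₀)) →
      (0 < β₂ ∧ β₂ ≤ Cb * (N:ℝ) ^ pb ∧ 1 / β₂ ≤ Cb * (N:ℝ) ^ pb) →
      (∃ h : ℝ → ℝ, HolderClass1 m α h ∧
        (∀ x ∈ I01, 0 < h x) ∧ StrictAntiOn h I01 ∧
        (∀ j, 1 ≤ j → j ≤ m → iteratedDerivWithin j h I01 0 = 0) ∧
        ∀ ζ : Fin N → ℝ, (∀ j, |ζ j| ≤ B₁ * (N:ℝ) ^ r₁) →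
          ∃ x ∈ I01,
            C' / ((N:ℝ) ^ ((m:ℝ) + α + 1) * (Real.log N) ^ ((m:ℝ) + α + 1)) ≤
              ‖((∫ s in (0:ℝ)..x, h s : ℝ) : ℂ) - ((1 / β₂ : ℝ) : ℂ) *
                (ψ₂x x (fun j => (ζ j : ℂ)) / ψ₂ x (fun j => (ζ j : ℂ)))‖) := by
  obtain ⟨κ, hκ0, hκ1, hT⟩ := testB2 m hm α hα0 hα1
  set q : ℝ := 1 / 2 with hq
  have hq0 : 0 < q := by norm_num [hq]
  have hq1 : q < 1 := by norm_num [hq]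
  obtain ⟨a₁, ha₁, c₁, hg₁⟩ := growth_bound A u v b t d (B₁ / q) 0 (r₁ + 1) 0
    (by linarith) (by linarith) (by linarith) (by linarith) (by positivity) le_rfl
  obtain ⟨aa, haa, cc, hpoly⟩ := (((PolyB.rpow (3 * Cb) pb (by linarith)).add
    (PolyB.const C₀ hC₀.le)).add (PolyB.npow a₁ ha₁ c₁)).add
    (PolyB.rpow α₀ β₀ hα₀.le)
  have hm0 : (0:ℝ) < m := by exact_mod_cast hm
  obtain ⟨C', hC', hmid⟩ := middle ((m:ℝ) + α + 1) κ q aa (by linarith) hκ0 hκ1 hq0 hq1 haa cc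
  refine ⟨C', hC', ?_⟩
  intro N hN ψ ψx β hψ hψa hψxa hψb hψxb hinv ⟨hβ0, hβ1, hβ2⟩
  obtain ⟨P, hP, hthr, hmid⟩ := hmid N hN
  obtain ⟨xs, g, hxs, hg, hT⟩ := hT P hP
  set n : ℝ := (N:ℝ) with hn
  have hN2 : (2:ℝ) ≤ n := by rw [hn]; exact_mod_cast hN
  have hn1 : 1 ≤ n := by linarith
  have hn0 : 0 < n := by linarith
  have hpol := hpoly n hn1
  set X : ℝ := aa * n ^ cc with hX
  have p1 : 0 ≤ Cb * n ^ pb := by positivity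
  have p4 : 0 ≤ a₁ * n ^ c₁ := by positivity
  have p6 : 0 ≤ α₀ * n ^ β₀ := by positivity
  have hpol' : 3 * (Cb * n ^ pb) + C₀ + a₁ * n ^ c₁ + α₀ * n ^ β₀ ≤ X := by
    refine le_trans (le_of_eq ?_) hpol
    ring
  -- polydisc
  let cen : Fin N → ℂ := fun _ => 0
  let ρ : Fin N → ℝ := fun _ => B₁ * n ^ r₁
  have hρ0 : ∀ j, 0 < ρ j := fun j => by simp only [ρ]; positivity
  have hsum1 : ∀ z : Fin N → ℂ, (∀ j, z j ∈ Metric.closedBall (cen j) (ρ j / q)) →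
      ∑ j, ‖z j‖ ≤ B₁ / q * n ^ (r₁ + 1) := by
    intro z hz
    have e1 : ∀ j : Fin N, ‖z j‖ ≤ B₁ / q * n ^ r₁ := by
      intro j
      have := hz j
      rw [mem_closedBall_iff_norm] at this
      simp only [cen, ρ, sub_zero] at this
      refine this.trans (le_of_eq (by ring))
    calc ∑ j, ‖z j‖ ≤ ∑ _j : Fin N, B₁ / q * n ^ r₁ := Finset.sum_le_sum fun j _ => e1 j
      _ = n * (B₁ / q * n ^ r₁) := by simp [hn]
      _ = _ := by rw [Real.rpow_add_one hn0.ne']; ring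
  have hE : ∀ z : Fin N → ℂ, (∀ j, z j ∈ Metric.closedBall (cen j) (ρ j / q)) →
      A * Real.exp (u * n ^ v) * Real.exp (b * n ^ t * (∑ j, ‖z j‖) ^ d) ≤
        Real.exp (a₁ * n ^ c₁) := by
    intro z hz
    refine le_trans ?_ (hg₁ n hn1 (∑ j, ‖z j‖) 0
      (Finset.sum_nonneg fun _ _ => norm_nonneg _) (hsum1 z hz) le_rfl (by simp))
    have : (0:ℝ) ≤ 0 ^ d := Real.rpow_nonneg le_rfl d
    gcongr
    linarith
  have hβe : 1 / β ≤ Real.exp (Cb * n ^ pb) :=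
    hβ2.trans (by linarith [Real.add_one_le_exp (Cb * n ^ pb)])
  have hdiff : ∀ G : (Fin N → ℂ) → ℂ, AnalyticOnNhd ℂ G univ → ∀ (z : Fin N → ℂ) (j : Fin N)
      (D : Set ℂ), DifferentiableOn ℂ (fun s => G (Function.update z j s)) D := by
    intro G hG z j D s _
    exact ((hG _ (mem_univ _)).differentiableAt.comp s
      (hasFDerivAt_update z s).differentiableAt).differentiableWithinAt
  -- the two families
  let Num : Bool → Fin P → (Fin N → ℂ) → ℂ := fun f i z =>
    if f then ((1 / β : ℝ) : ℂ) * ψx (xs i) z else 0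
  let Den : Bool → Fin P → (Fin N → ℂ) → ℂ := fun f i z =>
    if f then ψ (xs i) z else 1
  obtain ⟨s, hs⟩ := hmid (Fin N) (by simp) cen ρ hρ0 Num Den
    (by
      intro f i z hz j
      cases f
      · exact differentiableOn_const _
      · exact (hdiff _ (hψxa (xs i) (hxs i)) z j _).const_mul _)
    (by
      intro f i z hz j
      cases f
      · exact differentiableOn_const _
      · exact hdiff _ (hψa (xs i) (hxs i)) z j _)
    (by
      intro f i z hz
      have b1 := (hψb z (xs i) (hxs i)).trans (hE z hz)
      have b2 := (hψxb z (xs i) (hxs i)).trans (hE z hz)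
      cases f
      · constructor
        · change ‖(0:ℂ)‖ ≤ _
          rw [norm_zero]
          exact (Real.exp_pos _).le
        · change ‖(1:ℂ)‖ ≤ _
          rw [norm_one]
          exact Real.one_le_exp (by linarith)
      · constructor
        · change ‖((1 / β : ℝ) : ℂ) * ψx (xs i) z‖ ≤ _
          rw [norm_mul, Complex.norm_real, Real.norm_of_nonneg (by positivity)]
          calc _ ≤ Real.exp (Cb * n ^ pb) * Real.exp (a₁ * n ^ c₁) := by gcongr
            _ = Real.exp (Cb * n ^ pb + a₁ * n ^ c₁) := (Real.exp_add _ _).symm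
            _ ≤ _ := Real.exp_le_exp.2 (by linarith)
        · exact b1.trans (Real.exp_le_exp.2 (by linarith)))
    g hg
  obtain ⟨h, h1, h2, h3, h4, h5, h6⟩ := hT s
  refine ⟨h, h1, h2, h3, h4, ?_⟩
  intro ζ hΩ
  by_contra hcon
  push Not at hcon
  have hPL : κ * (P:ℝ) ^ (-((m:ℝ) + α + 1)) / 10 ≤ 1 := by
    have : (P:ℝ) ^ (-((m:ℝ) + α + 1)) ≤ 1 :=
      Real.rpow_le_one_of_one_le_of_nonpos (by exact_mod_cast hP) (by linarith)
    have : 0 ≤ (P:ℝ) ^ (-((m:ℝ) + α + 1)) := by positivity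
    nlinarith
  set ζc : Fin N → ℂ := fun j => (ζ j : ℂ) with hζc
  have hi1 := hinv ζ hΩ
  have hQ : ∀ x ∈ Icc (0:ℝ) 1, ‖ψx x ζc / ψ x ζc‖ ≤ 2 * β := by
    intro x hx
    have e1 := hcon x hx
    set Q := ψx x ζc / ψ x ζc with hQdef
    set H : ℝ := ∫ s in (0:ℝ)..x, h s with hH
    have e2 : ‖((1 / β : ℝ) : ℂ) * Q‖ ≤ 2 := by
      have e3 := norm_sub_le (H : ℂ) ((H : ℂ) - ((1 / β : ℝ) : ℂ) * Q)
      rw [sub_sub_cancel] at e3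
      have e4 : ‖(H : ℂ)‖ ≤ 1 := by
        rw [Complex.norm_real, Real.norm_eq_abs]; exact h5 x hx
      linarith
    rw [norm_mul, Complex.norm_real, Real.norm_of_nonneg (by positivity), one_div,
      inv_mul_le_iff₀ hβ0] at e2
    linarith
  have hK0 : 0 ≤ 2 * β := by positivity
  obtain ⟨D1, D2⟩ := dich1 (fun x => ψ x ζc) (fun x => ψx x ζc)
    (fun x hx => hψ ζc x hx) _ hK0 hQ
  have hz : ∀ j, ζc j ∈ Metric.closedBall (cen j) (ρ j) := by
    intro j
    rw [mem_closedBall_iff_norm]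
    simp only [cen, ρ, sub_zero, hζc, Complex.norm_real, Real.norm_eq_abs]
    exact hΩ j
  by_cases h0 : ψ 0 ζc = 0
  · have hv := D2 h0
    obtain ⟨i, hi⟩ := hs false ζc hz (by
      intro i
      change _ ≤ ‖(1:ℂ)‖
      rw [norm_one, Real.exp_le_one_iff]
      linarith)
    have e1 := (hcon (xs i) (hxs i)).trans_le hthr
    have e2 : ψ (xs i) ζc = 0 := hv (xs i) (hxs i)
    rw [← h6 i] at hi
    have e3 : Num false i ζc / Den false i ζc = 0 := by
      change (0:ℂ) / 1 = _
      rw [div_one]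
    rw [e3] at hi
    rw [e2, div_zero, mul_zero] at e1
    exact lt_asymm hi e1
  · have hv := D1 h0
    have hlow : ∀ x ∈ I01, Real.exp (-(C₀ + α₀ * n ^ β₀ + 2 * β)) ≤ ‖ψ x ζc‖ := by
      intro x hx
      have e1 := hv x hx
      have e0 : 0 < ‖ψ 0 ζc‖ := norm_pos_iff.2 h0
      have e2 : 1 ≤ Real.exp (C₀ + α₀ * n ^ β₀) * ‖ψ 0 ζc‖ := by
        rw [norm_inv, inv_le_iff_one_le_mul₀ e0] at hi1
        refine hi1.trans ?_
        rw [Real.exp_add]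
        gcongr
        linarith [Real.add_one_le_exp C₀]
      rw [Real.exp_neg, inv_le_iff_one_le_mul₀ (Real.exp_pos _), Real.exp_add]
      calc 1 ≤ Real.exp (C₀ + α₀ * n ^ β₀) * ‖ψ 0 ζc‖ := e2
        _ ≤ Real.exp (C₀ + α₀ * n ^ β₀) * (Real.exp (2 * β) * ‖ψ x ζc‖) := by
          gcongr
        _ = _ := by ring
    obtain ⟨i, hi⟩ := hs true ζc hz (by
      intro i
      change _ ≤ ‖ψ (xs i) ζc‖
      refine le_trans (Real.exp_le_exp.2 ?_) (hlow _ (hxs i))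
      linarith)
    have e1 := (hcon (xs i) (hxs i)).trans_le hthr
    rw [← h6 i] at hi
    have e3 : Num true i ζc / Den true i ζc = ((1 / β : ℝ) : ℂ) * (ψx (xs i) ζc / ψ (xs i) ζc) := by
      change ((1 / β : ℝ) : ℂ) * ψx (xs i) ζc / ψ (xs i) ζc = _
      rw [mul_div_assoc]
    rw [e3] at hi
    exact lt_asymm hi e1

/-- **Refinement with positive strictly decreasing test functions.** Under the hypotheses
of the lower bounds for approximation by logarithmic-derivative families (second-order
family `(1/b_{M,N})(k + ∂ₓ((∂ₓψ)/ψ))` on `Ω_{N,M}`, and first-order antiderivative family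
`(1/b_N)((∂ₓψ₂)/ψ₂)`), the extremal function `h ∈ Λ_l([0,1]) ∩ C^m([0,1])` realizing the
respective lower bound can in addition be chosen strictly positive, strictly decreasing,
and with `h^{(j)}(0) = 0` for `j = 1,…,m`. -/
theorem stmt_6 (m : ℕ) (hm : 1 ≤ m) (α : ℝ) (hα0 : 0 < α) (hα1 : α ≤ 1)
    (A u v b t d : ℝ) (hA : 1 ≤ A) (hu : 1 ≤ u) (hv : 1 ≤ v) (hb : 1 ≤ b)
    (ht : 1 ≤ t) (hd : 1 ≤ d)
    (Ak uk vk bk tk dk : ℝ) (hAk : 1 ≤ Ak) (huk : 1 ≤ uk) (hvk : 1 ≤ vk)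
    (hbk : 1 ≤ bk) (htk : 1 ≤ tk) (hdk : 1 ≤ dk)
    (B₁ B₂ r₁ r₂ : ℝ) (hB₁ : 1 ≤ B₁) (hB₂ : 1 ≤ B₂) (hr₁ : 1 ≤ r₁) (hr₂ : 1 ≤ r₂)
    (ε : ℝ) (hε0 : 0 < ε) (hε1 : ε < 1)
    (C₀ α₀ β₀ : ℝ) (hC₀ : 0 < C₀) (hα₀ : 0 < α₀) (hβ₀ : 0 < β₀)
    (Ck pk Cb pb : ℝ) (hCk : 0 < Ck) (hpk : 0 < pk) (hCb : 0 < Cb) (hpb : 0 < pb) :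
    ∃ C' : ℝ, 0 < C' ∧
      ∀ N M : ℕ, 2 ≤ N →
      -- data of the second-order family : ψ (with derivatives ψx, ψxx), k, b_{M,N}
      ∀ ψ ψx ψxx kf : ℝ → (Fin N → ℂ) → (Fin M → ℂ) → ℂ, ∀ β₁ : ℝ,
      -- data of the first-order family : ψ₂ (with derivative ψ₂x), b_N
      ∀ ψ₂ ψ₂x : ℝ → (Fin N → ℂ) → ℂ, ∀ β₂ : ℝ,
      ∀ a : Fin M → ℝ,
      -- hypotheses for the second-order family
      (∀ (ζ : Fin N → ℂ) (w : Fin M → ℂ), ∀ x ∈ I01,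
        HasDerivWithinAt (fun x' => ψ x' ζ w) (ψx x ζ w) I01 x) →
      (∀ (ζ : Fin N → ℂ) (w : Fin M → ℂ), ∀ x ∈ I01,
        HasDerivWithinAt (fun x' => ψx x' ζ w) (ψxx x ζ w) I01 x) →
      GoodFamily N M A u v b t d ψ →
      GoodFamily N M A u v b t d ψx →
      GoodFamily N M A u v b t d ψxx →
      GoodFamily N M Ak uk vk bk tk dk kf →
      (∀ i, 0 < a i ∧ a i ≤ B₂ * ((M:ℝ) + N) ^ r₂) →
      (∀ (ζ : Fin N → ℝ) (w : Fin M → ℝ), InOmega N M B₁ r₁ ε a ζ w → ∀ x ∈ I01,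
        ‖kf x (fun j => (ζ j : ℂ)) (fun i => (w i : ℂ))‖ ≤ Ck * ((N:ℝ) + M) ^ pk) →
      (∀ (ζ : Fin N → ℝ) (w : Fin M → ℝ), InOmega N M B₁ r₁ ε a ζ w →
        ‖(ψ 0 (fun j => (ζ j : ℂ)) (fun i => (w i : ℂ)))⁻¹‖
            ≤ C₀ * Real.exp (α₀ * ((M:ℝ) + N) ^ β₀) ∧
          ψx 0 (fun j => (ζ j : ℂ)) (fun i => (w i : ℂ)) = 0) →
      (0 < β₁ ∧ β₁ ≤ Cb * ((N:ℝ) + M) ^ pb ∧ 1 / β₁ ≤ Cb * ((N:ℝ) + M) ^ pb) →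
      -- hypotheses for the first-order family
      (∀ ζ : Fin N → ℂ, ∀ x ∈ I01,
        HasDerivWithinAt (fun x' => ψ₂ x' ζ) (ψ₂x x ζ) I01 x) →
      (∀ ζ : Fin N → ℂ, ContinuousOn (fun x => ψ₂ x ζ) I01) →
      (∀ ζ : Fin N → ℂ, ContinuousOn (fun x => ψ₂x x ζ) I01) →
      (∀ x ∈ I01, AnalyticOnNhd ℂ (fun ζ => ψ₂ x ζ) univ) →
      (∀ x ∈ I01, AnalyticOnNhd ℂ (fun ζ => ψ₂x x ζ) univ) →
      (∀ ζ : Fin N → ℂ, ∀ x ∈ I01,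
        ‖ψ₂ x ζ‖ ≤ A * Real.exp (u * (N:ℝ) ^ v) *
          Real.exp (b * (N:ℝ) ^ t * (∑ j, ‖ζ j‖) ^ d)) →
      (∀ ζ : Fin N → ℂ, ∀ x ∈ I01,
        ‖ψ₂x x ζ‖ ≤ A * Real.exp (u * (N:ℝ) ^ v) *
          Real.exp (b * (N:ℝ) ^ t * (∑ j, ‖ζ j‖) ^ d)) →
      (∀ ζ : Fin N → ℝ, (∀ j, |ζ j| ≤ B₁ * (N:ℝ) ^ r₁) →
        ‖(ψ₂ 0 (fun j => (ζ j : ℂ)))⁻¹‖ ≤ C₀ * Real.exp (α₀ * (N:ℝ) ^ β₀)) →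
      (0 < β₂ ∧ β₂ ≤ Cb * (N:ℝ) ^ pb ∧ 1 / β₂ ≤ Cb * (N:ℝ) ^ pb) →
      -- conclusion : extremal functions which are positive, strictly decreasing, with
      -- vanishing derivatives at 0
      (∃ h : ℝ → ℝ, HolderClass1 m α h ∧
        (∀ x ∈ I01, 0 < h x) ∧ StrictAntiOn h I01 ∧
        (∀ j, 1 ≤ j → j ≤ m → iteratedDerivWithin j h I01 0 = 0) ∧
        ∀ (ζ : Fin N → ℝ) (w : Fin M → ℝ), InOmega N M B₁ r₁ ε a ζ w →
          ∃ x ∈ I01,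
            C' / (((N:ℝ) + M) ^ ((m:ℝ) + α) * (Real.log ((N:ℝ) + M)) ^ ((m:ℝ) + α)) ≤
              ‖(h x : ℂ) - ((1 / β₁ : ℝ) : ℂ) *
                (kf x (fun j => (ζ j : ℂ)) (fun i => (w i : ℂ)) +
                  (ψxx x (fun j => (ζ j : ℂ)) (fun i => (w i : ℂ)) *
                      ψ x (fun j => (ζ j : ℂ)) (fun i => (w i : ℂ)) -
                    (ψx x (fun j => (ζ j : ℂ)) (fun i => (w i : ℂ))) ^ 2) /
                  (ψ x (fun j => (ζ j : ℂ)) (fun i => (w i : ℂ))) ^ 2)‖) ∧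
      (∃ h : ℝ → ℝ, HolderClass1 m α h ∧
        (∀ x ∈ I01, 0 < h x) ∧ StrictAntiOn h I01 ∧
        (∀ j, 1 ≤ j → j ≤ m → iteratedDerivWithin j h I01 0 = 0) ∧
        ∀ ζ : Fin N → ℝ, (∀ j, |ζ j| ≤ B₁ * (N:ℝ) ^ r₁) →
          ∃ x ∈ I01,
            C' / ((N:ℝ) ^ ((m:ℝ) + α + 1) * (Real.log N) ^ ((m:ℝ) + α + 1)) ≤
              ‖((∫ s in (0:ℝ)..x, h s : ℝ) : ℂ) - ((1 / β₂ : ℝ) : ℂ) *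
                (ψ₂x x (fun j => (ζ j : ℂ)) / ψ₂ x (fun j => (ζ j : ℂ)))‖) := by
  obtain ⟨C₁, hC₁, H₁⟩ := second_order m hm α hα0 hα1 A u v b t d hA hu hb hd Ak uk vk bk tk dk
    hAk huk hbk hdk B₁ B₂ r₁ r₂ hB₁ hB₂ ε hε0 hε1 C₀ α₀ β₀ hC₀ hα₀ Ck pk Cb pb hCk hCb
  obtain ⟨C₂, hC₂, H₂⟩ := first_order m hm α hα0 hα1 A u v b t d hA hu hb hd B₁ r₁ hB₁
    C₀ α₀ β₀ hC₀ hα₀ Cb pb hCb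
  refine ⟨min C₁ C₂, lt_min hC₁ hC₂, ?_⟩
  intro N M hN ψ ψx ψxx kf β₁ ψ₂ ψ₂x β₂ a g1 g2 g3 g4 g5 g6 g7 g8 g9 g10 g11 _ _ g14 g15 g16 g17
    g18 g19
  have hN2 : (2:ℝ) ≤ N := by exact_mod_cast hN
  have hM0 : (0:ℝ) ≤ M := by positivity
  constructor
  · obtain ⟨h, h1, h2, h3, h4, h5⟩ := H₁ N M hN ψ ψx ψxx kf β₁ a g1 g2 g3 g4 g5 g6 g7 g8 g9 g10
    refine ⟨h, h1, h2, h3, h4, ?_⟩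
    intro ζ w hΩ
    obtain ⟨x, hx, hb⟩ := h5 ζ w hΩ
    refine ⟨x, hx, le_trans ?_ hb⟩
    have hl : 0 ≤ Real.log ((N:ℝ) + M) := Real.log_nonneg (by linarith)
    exact div_le_div_of_nonneg_right (min_le_left _ _) (by positivity)
  · obtain ⟨h, h1, h2, h3, h4, h5⟩ := H₂ N hN ψ₂ ψ₂x β₂ g11 g14 g15 g16 g17 g18 g19
    refine ⟨h, h1, h2, h3, h4, ?_⟩
    intro ζ hΩ
    obtain ⟨x, hx, hb⟩ := h5 ζ hΩ
    refine ⟨x, hx, le_trans ?_ hb⟩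
    have hl : 0 ≤ Real.log (N:ℝ) := Real.log_nonneg (by linarith)
    exact div_le_div_of_nonneg_right (min_le_right _ _) (by positivity)

end
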